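/- arXiv:0901.2444 — 2 statements merged into one kernel-verified Lean document; each statement's English description precedes it below -/
import Mathlib

section
/- For M ∈ so(n) let L_M be the real linear span of the matrices π((M + λA)^j) for λ ∈ ℝ and j ∈ ℕ (the gradients of the Manakov integrals tr((M+λA)^k)), and let G_M = L_M + so(n)_A. Then there is an open dense subset U ⊆ so(n) such that for every M ∈ U the subspace G_M is coisotropic with respect to the Lie–Poisson structure at M: every ξ ∈ so(n) satisfying tr(M·[ξ, η]) = 0 for all η ∈ G_M belongs to G_M. (Completeness of the noncommutative family of Manakov integrals together with the linear Noether functions on so(n)_A; Theorem 1 of the paper.) -/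
open Matrix

/-- The skew-symmetric part `π(P) = (P − Pᵀ)/2` of a matrix. -/
noncomputable def skewPart {n : ℕ} (P : Matrix (Fin n) (Fin n) ℝ) :
    Matrix (Fin n) (Fin n) ℝ :=
  (1 / 2 : ℝ) • (P - Pᵀ)

/-- The gradients of the Manakov integrals `tr((M + λA)^k)` at `M`:
the matrices `π((M + λA)^j)`, `λ ∈ ℝ`, `j ∈ ℕ`. -/
noncomputable def manakovGradients {n : ℕ} (A M : Matrix (Fin n) (Fin n) ℝ) :
    Set (Matrix (Fin n) (Fin n) ℝ) :=
  {P | ∃ (lam : ℝ) (j : ℕ), P = skewPart ((M + lam • A) ^ j)}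

/-- The isotropy subalgebra `so(n)_A = {X ∈ so(n) : XA = AX}`. -/
def soA {n : ℕ} (A : Matrix (Fin n) (Fin n) ℝ) : Set (Matrix (Fin n) (Fin n) ℝ) :=
  {X | Xᵀ = -X ∧ X * A = A * X}

namespace Mnk
open Polynomial

section ringlemmas
variable {R : Type*} [CommRing R] {n : ℕ}

theorem aeval_comm {T D : Matrix (Fin n) (Fin n) R} (h : Commute T D) (q : R[X]) :
    Commute (aeval T q) D := by
  induction q using Polynomial.induction_on' with
  | add p q hp hq => rw [map_add]; exact hp.add_left hq
  | monomial k a =>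
    rw [aeval_monomial]
    exact Commute.mul_left (Algebra.commutes a D) (h.pow_left k)

theorem row_sum {ι : Type*} (S : Finset ι) (g : ι → Matrix (Fin n) (Fin n) R) (s : Fin n) :
    (∑ c ∈ S, g c) s = ∑ c ∈ S, (g c) s := by
  ext b
  rw [Matrix.sum_apply, Finset.sum_apply]

theorem vmv_single_mul (T : Matrix (Fin n) (Fin n) R) (u : Fin n → R) (j : Fin n) :
    vecMulVec u (Pi.single j 1) * T = ∑ l, T j l • vecMulVec u (Pi.single l (1 : R)) := by
  ext a b
  simp [Matrix.mul_apply, vecMulVec_apply, Matrix.sum_apply, Pi.single_apply, mul_comm]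

theorem lemA1 (T : Matrix (Fin n) (Fin n) R)
    (h0 : ∀ j k : Fin n, j.val + 1 < k.val → T j k = 0)
    (h1 : ∀ j k : Fin n, j.val + 1 = k.val → IsUnit (T j k))
    (z : Fin n) (hz : z.val = 0) (S : Submodule R (Matrix (Fin n) (Fin n) R))
    (hS1 : ∀ Z, T * Z - Z * T ∈ S) (hS2 : ∀ u, vecMulVec u (Pi.single z 1) ∈ S) :
    ∀ (m : ℕ) (k : Fin n), k.val = m → ∀ u, vecMulVec u (Pi.single k 1) ∈ S := by
  intro m
  induction m using Nat.strong_induction_on with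
  | _ m ih =>
  intro k hk u
  rcases Nat.eq_zero_or_pos m with h | h
  · have : k = z := Fin.ext (by omega)
    subst this; exact hS2 u
  · let j : Fin n := ⟨m - 1, by omega⟩
    have hjk : j.val + 1 = k.val := by simp [j]; omega
    have e := vmv_single_mul T u j
    rw [← Finset.add_sum_erase _ _ (Finset.mem_univ k)] at e
    have m1 : vecMulVec u (Pi.single j 1) * T ∈ S := by
      have a1 := hS1 (vecMulVec u (Pi.single j 1))
      have a2 : T * vecMulVec u (Pi.single j 1) ∈ S := by
        rw [Matrix.mul_vecMulVec]
        exact ih j.val (by omega) j rfl _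
      have := S.sub_mem a2 a1
      simpa using this
    have m2 : ∑ l ∈ Finset.univ.erase k, T j l • vecMulVec u (Pi.single l (1 : R)) ∈ S := by
      refine S.sum_mem fun l hl => ?_
      have hlk := (Finset.mem_erase.1 hl).1
      by_cases hlt : l.val < m
      · exact S.smul_mem _ (ih l.val hlt l rfl u)
      · have : l.val ≠ k.val := fun h => hlk (Fin.ext h)
        rw [h0 j l (by omega), zero_smul]; exact S.zero_mem
    have m3 : T j k • vecMulVec u (Pi.single k (1 : R)) ∈ S := by
      have := S.sub_mem m1 m2
      rw [e] at this
      simpa using this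
    obtain ⟨c, hc⟩ := h1 j k hjk
    rw [← hc] at m3
    have := S.smul_mem (↑c⁻¹ : R) m3
    rwa [smul_smul, Units.inv_mul, one_smul] at this

theorem lemA (T : Matrix (Fin n) (Fin n) R)
    (h0 : ∀ j k : Fin n, j.val + 1 < k.val → T j k = 0)
    (h1 : ∀ j k : Fin n, j.val + 1 = k.val → IsUnit (T j k))
    (z : Fin n) (hz : z.val = 0) (Y : Matrix (Fin n) (Fin n) R)
    (hY : ∀ i : ℕ, (Y * T ^ i).trace = 0) : ∃ Z, Y = T * Z - Z * T := by
  let S : Submodule R (Matrix (Fin n) (Fin n) R) :=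
    { carrier := {W | ∃ Z u, W = T * Z - Z * T + vecMulVec u (Pi.single z 1)}
      add_mem' := by
        rintro _ _ ⟨Z, u, rfl⟩ ⟨Z', u', rfl⟩
        refine ⟨Z + Z', u + u', ?_⟩
        rw [Matrix.add_vecMulVec]; noncomm_ring
      zero_mem' := ⟨0, 0, by simp⟩
      smul_mem' := by
        rintro c _ ⟨Z, u, rfl⟩
        refine ⟨c • Z, c • u, ?_⟩
        rw [Matrix.smul_vecMulVec]; simp [smul_sub] }
  have key : Y ∈ S := by
    have : Y = ∑ k, vecMulVec (fun i => Y i k) (Pi.single k (1 : R)) := by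
      ext a b
      simp [Matrix.sum_apply, vecMulVec_apply, Pi.single_apply]
    rw [this]
    refine S.sum_mem fun k _ => lemA1 T h0 h1 z hz S ?_ ?_ k.val k rfl _
    · intro Z; exact ⟨Z, 0, by simp⟩
    · intro u; exact ⟨0, u, by simp⟩
  obtain ⟨Z, u, rfl⟩ := key
  refine ⟨Z, ?_⟩
  have ht : ∀ i : ℕ, (T ^ i *ᵥ u) z = 0 := by
    intro i
    have := hY i
    rw [Matrix.add_mul, Matrix.trace_add, Matrix.sub_mul, Matrix.trace_sub] at this
    have e1 : (T * Z * T ^ i).trace = (Z * T * T ^ i).trace := by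
      rw [Matrix.mul_assoc, Matrix.trace_mul_comm, Matrix.mul_assoc, Matrix.mul_assoc,
        ← pow_succ, ← pow_succ']
    rw [e1, sub_self, zero_add, Matrix.vecMulVec_mul, Matrix.trace_vecMulVec] at this
    rw [← this]
    simp [Matrix.mulVec, dotProduct, mul_comm, Matrix.vecMul, Pi.single_apply]
  have hall : ∀ (m : ℕ) (k : Fin n), k.val = m → ∀ i : ℕ, (T ^ i *ᵥ u) k = 0 := by
    intro m
    induction m using Nat.strong_induction_on with
    | _ m ih =>
    intro k hk i
    rcases Nat.eq_zero_or_pos m with h | h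
    · have : k = z := Fin.ext (by omega)
      subst this; exact ht i
    · let j : Fin n := ⟨m - 1, by omega⟩
      have hjk : j.val + 1 = k.val := by simp [j]; omega
      have e := ih j.val (by omega) j rfl (i + 1)
      rw [pow_succ', ← Matrix.mulVec_mulVec, Matrix.mulVec, dotProduct,
        ← Finset.add_sum_erase _ _ (Finset.mem_univ k), Finset.sum_eq_zero, add_zero] at e
      · exact (h1 j k hjk).mul_right_eq_zero.1 e
      · intro l hl
        have hlk := (Finset.mem_erase.1 hl).1
        by_cases hlt : l.val < m
        · rw [ih l.val hlt l rfl i, mul_zero]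
        · have : l.val ≠ k.val := fun h => hlk (Fin.ext h)
          rw [h0 j l (by omega), zero_mul]
  have hu : u = 0 := by
    ext k
    simpa using hall k.val k rfl 0
  simp [hu]

theorem single_row_mul (T : Matrix (Fin n) (Fin n) R) (Q : Matrix (Fin n) (Fin n) R)
    (s j : Fin n) (h : Q s = Pi.single j 1) : (Q * T) s = T j := by
  ext b
  simp [Matrix.mul_apply, h, Pi.single_apply]

theorem lemB1 (T : Matrix (Fin n) (Fin n) R) (B : Fin n → Prop) (s : Fin n)
    (h0 : ∀ j k : Fin n, j.val + 1 < k.val → T j k = 0)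
    (hB : ∀ j k, B j → ¬ B k → T j k = 0)
    (hs : ∀ l, B l → s.val ≤ l.val)
    (h1 : ∀ k, B k → s.val < k.val → ∃ j : Fin n, B j ∧ j.val + 1 = k.val ∧ IsUnit (T j k)) :
    ∀ (m : ℕ) (k : Fin n), k.val = m → B k → ∃ q : R[X], (aeval T q) s = Pi.single k 1 := by
  intro m
  induction m using Nat.strong_induction_on with
  | _ m ih =>
  intro k hk hBk
  rcases (hs k hBk).eq_or_lt with h | h
  · have : s = k := Fin.ext h
    subst this
    refine ⟨1, ?_⟩
    ext b
    simp [Matrix.one_apply, Pi.single_apply, eq_comm]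
  · obtain ⟨j, hBj, hjk, hu⟩ := h1 k hBk h
    obtain ⟨qj, hqj⟩ := ih j.val (by omega) j rfl hBj
    have hc : ∀ l : Fin n, ∃ q : R[X], l ≠ k → T j l • (aeval T q) s = T j l • Pi.single l 1 := by
      intro l
      by_cases hBl : B l
      · by_cases hlt : l.val < m
        · obtain ⟨q, hq⟩ := ih l.val hlt l rfl hBl
          exact ⟨q, fun _ => by rw [hq]⟩
        · refine ⟨0, fun hlk => ?_⟩
          have : l.val ≠ k.val := fun h => hlk (Fin.ext h)
          rw [h0 j l (by omega)]; simp
      · refine ⟨0, fun _ => ?_⟩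
        rw [hB j l hBj hBl]; simp
    choose q hq using hc
    obtain ⟨c, hc⟩ := hu
    refine ⟨C (↑c⁻¹ : R) * (qj * X - ∑ l ∈ Finset.univ.erase k, C (T j l) * q l), ?_⟩
    have e1 : (aeval T (qj * X)) s = T j := by
      rw [map_mul, aeval_X]; exact single_row_mul T _ s j hqj
    have e2 : (aeval T (∑ l ∈ Finset.univ.erase k, C (T j l) * q l)) s
        = ∑ l ∈ Finset.univ.erase k, T j l • Pi.single l (1 : R) := by
      rw [map_sum, row_sum]
      refine Finset.sum_congr rfl fun l hl => ?_
      rw [← hq l (Finset.mem_erase.1 hl).1, map_mul, aeval_C, ← Algebra.smul_def]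
      rfl
    have e3 : T j = ∑ l, T j l • Pi.single l (1 : R) := by
      ext b; simp [Pi.single_apply]
    rw [map_mul, aeval_C, ← Algebra.smul_def, map_sub]
    change (↑c⁻¹ : R) • ((aeval T (qj * X)) s - (aeval T (∑ l ∈ Finset.univ.erase k, C (T j l) * q l)) s) = _
    rw [e1, e2]
    nth_rewrite 1 [e3]
    rw [← Finset.add_sum_erase _ _ (Finset.mem_univ k), add_sub_cancel_right, ← hc, smul_smul,
      Units.inv_mul, one_smul]

theorem lemB (T : Matrix (Fin n) (Fin n) R) (B : Fin n → Prop) (s : Fin n)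
    (hq : ∀ k : Fin n, B k → ∃ q : R[X], (aeval T q) s = Pi.single k 1)
    (D : Matrix (Fin n) (Fin n) R) (hD : T * D = D * T) (hDs : ∀ l, ¬ B l → D s l = 0) :
    ∃ q : R[X], ∀ j, B j → D j = (aeval T q) j := by
  have hc : ∀ l : Fin n, ∃ q : R[X], D s l • (aeval T q) s = D s l • Pi.single l 1 := by
    intro l
    by_cases hBl : B l
    · obtain ⟨q, hq⟩ := hq l hBl
      exact ⟨q, by rw [hq]⟩
    · exact ⟨0, by rw [hDs l hBl]; simp⟩
  choose q' hq' using hc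
  have e2 : (aeval T (∑ l, C (D s l) * q' l)) s = D s := by
    have e3 : D s = ∑ l, D s l • Pi.single l (1 : R) := by
      ext b; simp [Pi.single_apply]
    rw [map_sum, row_sum]; refine Eq.trans ?_ e3.symm
    refine Finset.sum_congr rfl fun l hl => ?_
    rw [← hq' l, map_mul, aeval_C, ← Algebra.smul_def]
    rfl
  refine ⟨∑ l, C (D s l) * q' l, fun j hj => ?_⟩
  set P := aeval T (∑ l, C (D s l) * q' l) with hP
  obtain ⟨q, hqj⟩ := hq j hj
  have c1 : Commute (aeval T q) (D - P) := by
    have hTD : Commute T D := hD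
    have hTP : Commute T P := by
      rw [hP]
      have := (Commute.all (X : R[X]) (∑ l, C (D s l) * q' l)).map (aeval T)
      rwa [aeval_X] at this
    have := (hTD.sub_right hTP)
    exact aeval_comm this q
  have r1 := single_row_mul (D - P) _ s j hqj
  rw [c1.eq] at r1
  have r2 : ((D - P) * (aeval T q)) s = 0 := by
    ext b
    rw [Matrix.mul_apply]
    refine Finset.sum_eq_zero fun l _ => ?_
    rw [Matrix.sub_apply, e2, sub_self, zero_mul]
  rw [r2] at r1
  exact (sub_eq_zero.1 r1.symm)
end ringlemmas
end Mnk

namespace Mnk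
open Polynomial

section coefs
variable {n : ℕ}

/-- coefficient of `λ^k` of a polynomial matrix -/
noncomputable def cf (k : ℕ) : Matrix (Fin n) (Fin n) ℝ[X] →ₗ[ℝ] Matrix (Fin n) (Fin n) ℝ :=
  (Polynomial.lcoeff ℝ k).mapMatrix

theorem cf_apply (k : ℕ) (P : Matrix (Fin n) (Fin n) ℝ[X]) (i j : Fin n) :
    cf k P i j = (P i j).coeff k := rfl

theorem cf_Cmul (k : ℕ) (M : Matrix (Fin n) (Fin n) ℝ) (P : Matrix (Fin n) (Fin n) ℝ[X]) :
    cf k (M.map C * P) = M * cf k P := by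
  ext i j
  simp [cf_apply, Matrix.mul_apply, finsetSum_coeff, coeff_C_mul]

theorem cf_mulC (k : ℕ) (M : Matrix (Fin n) (Fin n) ℝ) (P : Matrix (Fin n) (Fin n) ℝ[X]) :
    cf k (P * M.map C) = cf k P * M := by
  ext i j
  simp [cf_apply, Matrix.mul_apply, finsetSum_coeff, coeff_mul_C]

theorem cf_Xsmul_succ (k : ℕ) (P : Matrix (Fin n) (Fin n) ℝ[X]) :
    cf (k + 1) ((X : ℝ[X]) • P) = cf k P := by
  ext i j
  simp [cf_apply]

theorem cf_Xsmul_zero (P : Matrix (Fin n) (Fin n) ℝ[X]) :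
    cf 0 ((X : ℝ[X]) • P) = 0 := by
  ext i j
  simp [cf_apply]

theorem cf_Xpow_smul (m k : ℕ) (P : Matrix (Fin n) (Fin n) ℝ[X]) :
    cf (k + m) ((X ^ m : ℝ[X]) • P) = cf k P := by
  ext i j
  simp [cf_apply, coeff_X_pow_mul]

/-- The polynomial matrix `M + λ A`. -/
noncomputable def TT (A M : Matrix (Fin n) (Fin n) ℝ) : Matrix (Fin n) (Fin n) ℝ[X] :=
  M.map C + (X : ℝ[X]) • A.map C

theorem cf_T_mul_succ (A M : Matrix (Fin n) (Fin n) ℝ) (k : ℕ) (P) :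
    cf (k + 1) (TT A M * P) = M * cf (k + 1) P + A * cf k P := by
  rw [TT, add_mul, map_add, cf_Cmul, smul_mul_assoc, cf_Xsmul_succ, cf_Cmul]

theorem cf_T_mul_zero (A M : Matrix (Fin n) (Fin n) ℝ) (P) :
    cf 0 (TT A M * P) = M * cf 0 P := by
  rw [TT, add_mul, map_add, cf_Cmul, smul_mul_assoc, cf_Xsmul_zero, add_zero]

theorem cf_mul_T_succ (A M : Matrix (Fin n) (Fin n) ℝ) (k : ℕ) (P) :
    cf (k + 1) (P * TT A M) = cf (k + 1) P * M + cf k P * A := by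
  rw [TT, mul_add, map_add, cf_mulC, mul_smul_comm, cf_Xsmul_succ, cf_mulC]

theorem cf_mul_T_zero (A M : Matrix (Fin n) (Fin n) ℝ) (P) :
    cf 0 (P * TT A M) = cf 0 P * M := by
  rw [TT, mul_add, map_add, cf_mulC, mul_smul_comm, cf_Xsmul_zero, add_zero]

/-- span of all coefficients of powers of `M + λ A` -/
noncomputable def Lt (A M : Matrix (Fin n) (Fin n) ℝ) : Submodule ℝ (Matrix (Fin n) (Fin n) ℝ) :=
  Submodule.span ℝ {P | ∃ k j : ℕ, P = cf k (TT A M ^ j)}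

theorem cf_mem_Lt (A M : Matrix (Fin n) (Fin n) ℝ) (f : ℝ[X][X]) (k : ℕ) :
    cf k (aeval (TT A M) f) ∈ Lt A M := by
  induction f using Polynomial.induction_on' with
  | add p q hp hq => rw [map_add, map_add]; exact add_mem hp hq
  | monomial j a =>
    rw [aeval_monomial, ← Algebra.smul_def]
    induction a using Polynomial.induction_on' with
    | add p q hp hq => rw [add_smul, map_add]; exact add_mem hp hq
    | monomial b c =>
      rw [← C_mul_X_pow_eq_monomial, mul_smul]
      have e : (C c : ℝ[X]) • ((X ^ b : ℝ[X]) • TT A M ^ j) = c • ((X ^ b : ℝ[X]) • TT A M ^ j) := by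
        ext1 i l; simp [Matrix.smul_apply, smul_eq_C_mul]
      rw [e, map_smul]
      refine Submodule.smul_mem _ _ ?_
      by_cases h : b ≤ k
      · obtain ⟨d, rfl⟩ := Nat.exists_eq_add_of_le' h
        rw [cf_Xpow_smul]
        exact Submodule.subset_span ⟨_, _, rfl⟩
      · have : cf k ((X ^ b : ℝ[X]) • TT A M ^ j) = 0 := by
          ext i l
          simp [cf_apply, coeff_X_pow_mul', h]
        rw [this]; exact zero_mem _

theorem comm_T (A M : Matrix (Fin n) (Fin n) ℝ) (f : ℝ[X][X]) :
    TT A M * aeval (TT A M) f = aeval (TT A M) f * TT A M :=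
  (aeval_comm (Commute.refl _) f).symm

theorem chain_succ (A M : Matrix (Fin n) (Fin n) ℝ) (P) (h : TT A M * P = P * TT A M) (k : ℕ) :
    (M * cf (k + 1) P - cf (k + 1) P * M) + (A * cf k P - cf k P * A) = 0 := by
  have := congrArg (cf (k + 1)) h
  rw [cf_T_mul_succ, cf_mul_T_succ] at this
  rw [← sub_eq_zero] at this
  rw [← this]; abel

theorem chain_zero (A M : Matrix (Fin n) (Fin n) ℝ) (P) (h : TT A M * P = P * TT A M) :
    M * cf 0 P - cf 0 P * M = 0 := by
  have := congrArg (cf 0) h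
  rw [cf_T_mul_zero, cf_mul_T_zero] at this
  rw [this, sub_self]

/-- degree bound -/
def DB (d : ℕ) (P : Matrix (Fin n) (Fin n) ℝ[X]) : Prop := ∀ i j, (P i j).natDegree ≤ d

theorem DB.cf_zero {d : ℕ} {P : Matrix (Fin n) (Fin n) ℝ[X]} (h : DB d P) {k : ℕ} (hk : d < k) :
    cf k P = 0 := by
  ext i j
  exact coeff_eq_zero_of_natDegree_lt ((h i j).trans_lt hk)

theorem DB.mul {d e : ℕ} {P Q : Matrix (Fin n) (Fin n) ℝ[X]} (h : DB d P) (h' : DB e Q) :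
    DB (d + e) (P * Q) := by
  intro i j
  rw [Matrix.mul_apply]
  exact natDegree_sum_le_of_forall_le _ _ fun l _ => natDegree_mul_le_of_le (h i l) (h' l j)

theorem cf_mul {d e : ℕ} {P Q : Matrix (Fin n) (Fin n) ℝ[X]} (h : DB d P) (h' : DB e Q) :
    cf (d + e) (P * Q) = cf d P * cf e Q := by
  ext i j
  rw [cf_apply, Matrix.mul_apply, Matrix.mul_apply, finsetSum_coeff]
  exact Finset.sum_congr rfl fun l _ => coeff_mul_add_eq_of_natDegree_le (h i l) (h' l j)

theorem DB_one : DB 0 (1 : Matrix (Fin n) (Fin n) ℝ[X]) := by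
  intro i j
  by_cases h : i = j <;> simp [Matrix.one_apply, h]

theorem cf_one : cf 0 (1 : Matrix (Fin n) (Fin n) ℝ[X]) = 1 := by
  ext i j
  by_cases h : i = j <;> simp [cf_apply, Matrix.one_apply, h]

theorem DB.pow {d : ℕ} {P : Matrix (Fin n) (Fin n) ℝ[X]} (h : DB d P) (k : ℕ) :
    DB (k * d) (P ^ k) ∧ cf (k * d) (P ^ k) = cf d P ^ k := by
  induction k with
  | zero => simp [DB_one, cf_one]
  | succ k ih =>
    rw [pow_succ, Nat.succ_mul, pow_succ]
    exact ⟨ih.1.mul h, by rw [cf_mul ih.1 h, ih.2]⟩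

theorem exists_DB (P : Matrix (Fin n) (Fin n) ℝ[X]) : ∃ d, DB d P := by
  refine ⟨∑ i, ∑ j, (P i j).natDegree, fun i j => ?_⟩
  calc (P i j).natDegree ≤ ∑ j, (P i j).natDegree :=
        Finset.single_le_sum (f := fun j => (P i j).natDegree) (fun _ _ => Nat.zero_le _) (Finset.mem_univ j)
    _ ≤ _ := Finset.single_le_sum (f := fun i => ∑ j, (P i j).natDegree) (fun _ _ => Nat.zero_le _) (Finset.mem_univ i)
end coefs

section blocks
variable {n r : ℕ} (blk : Fin n → Fin r) (α : Fin r → ℝ)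

/-- linear factor `Y - α_q λ` -/
noncomputable def fac (q : Fin r) : ℝ[X][X] := X - C (C (α q) * X)

theorem aeval_fac (A M : Matrix (Fin n) (Fin n) ℝ) (q : Fin r) :
    aeval (TT A M) (fac α q) = M.map C + (X : ℝ[X]) • (A - α q • 1).map C := by
  rw [fac, map_sub, aeval_X, aeval_C, Algebra.algebraMap_eq_smul_one, TT]
  ext1 i j
  by_cases h : i = j
  · simp [Matrix.one_apply, h]; ring
  · simp [Matrix.one_apply, h]

theorem DB_fac (A M : Matrix (Fin n) (Fin n) ℝ) (q : Fin r) :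
    DB 1 (aeval (TT A M) (fac α q)) := by
  rw [aeval_fac]
  intro i j
  simp only [Matrix.add_apply, Matrix.map_apply, Matrix.smul_apply, smul_eq_mul]
  compute_degree

theorem cf_fac (A M : Matrix (Fin n) (Fin n) ℝ) (q : Fin r) :
    cf 1 (aeval (TT A M) (fac α q)) = A - α q • 1 := by
  rw [aeval_fac]
  ext i j
  simp [cf_apply, coeff_C]

theorem prod_fac (M : Matrix (Fin n) (Fin n) ℝ) (s : Finset (Fin r)) :
    DB s.card (aeval (TT (diagonal fun i => α (blk i)) M) (∏ q ∈ s, fac α q)) ∧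
    cf s.card (aeval (TT (diagonal fun i => α (blk i)) M) (∏ q ∈ s, fac α q)) =
      diagonal fun i => ∏ q ∈ s, (α (blk i) - α q) := by
  induction s using Finset.induction_on with
  | empty => simp [DB_one, cf_one]
  | insert q s hq ih =>
    rw [Finset.prod_insert hq, Finset.card_insert_of_notMem hq, add_comm, map_mul]
    refine ⟨(DB_fac α _ M q).mul ih.1, ?_⟩
    rw [cf_mul (DB_fac α _ M q) ih.1, ih.2, cf_fac, smul_one_eq_diagonal, diagonal_sub,
      diagonal_mul_diagonal]
    simp [Finset.prod_insert hq]

/-- the block diagonal part -/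
def bd (M : Matrix (Fin n) (Fin n) ℝ) : Matrix (Fin n) (Fin n) ℝ :=
  Matrix.of fun i j => if blk i = blk j then M i j else 0

/-- the constants `c_p` -/
noncomputable def cc (p : Fin r) : ℝ := ∏ q ∈ Finset.univ.erase p, (α p - α q)

theorem cc_ne (hα : Function.Injective α) (p : Fin r) : cc α p ≠ 0 := by
  rw [cc, Finset.prod_ne_zero_iff]
  intro q hq
  exact sub_ne_zero.2 fun h => (Finset.mem_erase.1 hq).1 (hα h).symm

/-- block projections -/
def EE (p : Fin r) : Matrix (Fin n) (Fin n) ℝ := diagonal fun i => if blk i = p then 1 else 0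

theorem cf_h (M : Matrix (Fin n) (Fin n) ℝ) (p : Fin r) :
    DB (r - 1) (aeval (TT (diagonal fun i => α (blk i)) M) (∏ q ∈ Finset.univ.erase p, fac α q)) ∧
    cf (r - 1) (aeval (TT (diagonal fun i => α (blk i)) M) (∏ q ∈ Finset.univ.erase p, fac α q)) =
      cc α p • EE blk p := by
  have := prod_fac blk α M (Finset.univ.erase p)
  rw [Finset.card_erase_of_mem (Finset.mem_univ p), Finset.card_univ, Fintype.card_fin] at this
  refine ⟨this.1, this.2.trans ?_⟩
  rw [EE, ← diagonal_smul]
  congr 1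
  ext i
  by_cases h : blk i = p
  · simp [h, cc]
  · simp only [Pi.smul_apply, h, if_false, smul_zero]
    exact Finset.prod_eq_zero (Finset.mem_erase.2 ⟨h, Finset.mem_univ _⟩) (sub_self _)

theorem cf_chi (M : Matrix (Fin n) (Fin n) ℝ) :
    DB (r - 1) (aeval (TT (diagonal fun i => α (blk i)) M) (∏ q, fac α q)) ∧
    cf (r - 1) (aeval (TT (diagonal fun i => α (blk i)) M) (∏ q, fac α q)) =
      (diagonal fun i => cc α (blk i)) * bd blk M := by
  have h := prod_fac blk α M Finset.univ
  rw [Finset.card_univ, Fintype.card_fin] at h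
  constructor
  · intro i j
    rw [natDegree_le_iff_coeff_eq_zero]
    intro k hk
    have hr : 0 < r := (Nat.zero_le _).trans_lt (blk i).isLt
    rcases (show r ≤ k by omega).eq_or_lt with rfl | hk'
    · have := congrFun (congrFun h.2 i) j
      rw [cf_apply] at this
      rw [this]
      by_cases hij : i = j
      · subst hij
        rw [diagonal_apply_eq]
        exact Finset.prod_eq_zero (Finset.mem_univ (blk i)) (sub_self _)
      · rw [diagonal_apply_ne _ hij]
    · exact coeff_eq_zero_of_natDegree_lt ((h.1 i j).trans_lt hk')
  · ext i j
    have h2 := cf_h blk α M (blk i)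
    rw [← Finset.mul_prod_erase _ _ (Finset.mem_univ (blk i)), map_mul, aeval_fac]
    set Q := aeval (TT (diagonal fun i => α (blk i)) M) (∏ q ∈ Finset.univ.erase (blk i), fac α q)
    rw [add_mul, map_add, cf_Cmul, h2.2, smul_mul_assoc, Matrix.add_apply]
    have z : cf (r - 1) ((X : ℝ[X]) • (((diagonal fun i => α (blk i)) - α (blk i) • 1 :
        Matrix (Fin n) (Fin n) ℝ).map C * Q)) i j = 0 := by
      rw [cf_apply, Matrix.smul_apply, Matrix.mul_apply, Finset.sum_eq_zero]
      · simp
      · intro l _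
        by_cases hil : i = l
        · subst hil; simp
        · simp [hil]
    rw [z, add_zero, diagonal_mul, EE, mul_smul_comm, Matrix.smul_apply, mul_diagonal, bd]
    by_cases hb : blk i = blk j
    · simp [hb]
    · simp [hb, Ne.symm hb]

/-- leading coefficients -/
def HH (A M : Matrix (Fin n) (Fin n) ℝ) : Set (Matrix (Fin n) (Fin n) ℝ) :=
  {D | ∃ (d : ℕ) (f : ℝ[X][X]), DB d (aeval (TT A M) f) ∧ cf d (aeval (TT A M) f) = D}

theorem EE_bd (M : Matrix (Fin n) (Fin n) ℝ) (p : Fin r) :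
    EE blk p * bd blk M = bd blk M * EE blk p := by
  ext i j
  rw [EE, diagonal_mul, mul_diagonal, bd, of_apply]
  by_cases h : blk i = blk j <;> simp [h]

theorem EE_pow (M : Matrix (Fin n) (Fin n) ℝ) (p : Fin r) (i : ℕ) :
    EE blk p * ((diagonal fun i => cc α (blk i)) * bd blk M) ^ i =
      cc α p ^ i • (EE blk p * bd blk M ^ i) := by
  induction i with
  | zero => simp
  | succ i ih =>
    rw [pow_succ, ← mul_assoc, ih, smul_mul_assoc, mul_assoc, pow_succ' (bd blk M)]
    have h1 : EE blk p * bd blk M ^ i = bd blk M ^ i * EE blk p :=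
      (Commute.pow_right (EE_bd blk M p) i).eq
    have h2 : EE blk p * diagonal (fun i => cc α (blk i)) = cc α p • EE blk p := by
      rw [EE, diagonal_mul_diagonal, ← diagonal_smul]
      congr 1; ext i
      by_cases h : blk i = p <;> simp [h]
    rw [← mul_assoc, h1, mul_assoc (bd blk M ^ i), ← mul_assoc (EE blk p), h2, smul_mul_assoc, EE_bd,
      mul_smul_comm, smul_smul, ← mul_assoc, ← pow_succ, ← pow_succ, ← pow_succ',
      (Commute.pow_right (EE_bd blk M p) (i + 1)).eq]

theorem EE_mem (hα : Function.Injective α) (M : Matrix (Fin n) (Fin n) ℝ) (p : Fin r) (i : ℕ) :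
    EE blk p * bd blk M ^ i ∈ Submodule.span ℝ (HH (diagonal fun i => α (blk i)) M) := by
  have h1 := cf_h blk α M p
  have h2 := (cf_chi blk α M).1.pow i
  rw [(cf_chi blk α M).2] at h2
  have h3 : (cc α p * cc α p ^ i) • (EE blk p * bd blk M ^ i) ∈
      Submodule.span ℝ (HH (diagonal fun i => α (blk i)) M) := by
    refine Submodule.subset_span ⟨(r - 1) + i * (r - 1), (∏ q ∈ Finset.univ.erase p, fac α q) * (∏ q, fac α q) ^ i, ?_, ?_⟩
    · rw [map_mul, map_pow]; exact h1.1.mul h2.1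
    · rw [map_mul, map_pow, cf_mul h1.1 h2.1, h1.2, h2.2, smul_mul_assoc, EE_pow, smul_smul]
  have := Submodule.smul_mem _ (cc α p * cc α p ^ i)⁻¹ h3
  have hc := cc_ne α hα p
  rwa [smul_smul, inv_mul_cancel₀ (mul_ne_zero hc (pow_ne_zero _ hc)), one_smul] at this

end blocks
end Mnk

namespace Mnk
open Polynomial

section core
variable {n r : ℕ} (blk : Fin n → Fin r) (α : Fin r → ℝ)

/-- The special tridiagonal point. -/
def M0 (n : ℕ) : Matrix (Fin n) (Fin n) ℝ :=
  Matrix.of fun i j => if i.val + 1 = j.val then 1 else if j.val + 1 = i.val then -1 else 0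

theorem M0_skew (n : ℕ) : (M0 n)ᵀ = - M0 n := by
  ext i j
  rw [transpose_apply, Matrix.neg_apply]
  simp only [M0, of_apply]
  split_ifs <;> first | omega | simp

theorem M0_hess (j k : Fin n) (h : j.val + 1 < k.val) : M0 n j k = 0 := by
  simp only [M0, of_apply]
  split_ifs <;> first | omega | simp

theorem M0_sup (j k : Fin n) (h : j.val + 1 = k.val) : M0 n j k = 1 := by
  simp [M0, h]

theorem block_of_comm (hα : Function.Injective α) (D : Matrix (Fin n) (Fin n) ℝ)
    (h : (diagonal fun i => α (blk i)) * D - D * (diagonal fun i => α (blk i)) = 0)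
    (i j : Fin n) (hij : blk i ≠ blk j) : D i j = 0 := by
  have := congrFun (congrFun h i) j
  rw [Matrix.sub_apply, diagonal_mul, mul_diagonal, mul_comm (D i j), ← sub_mul] at this
  exact (mul_eq_zero.1 this).resolve_left (sub_ne_zero.2 fun h => hij (hα h))

theorem comm_block (D : Matrix (Fin n) (Fin n) ℝ) (i j : Fin n) (hij : blk i = blk j) :
    ((diagonal fun i => α (blk i)) * D - D * (diagonal fun i => α (blk i))) i j = 0 := by
  rw [Matrix.sub_apply, diagonal_mul, mul_diagonal, mul_comm (D i j), ← sub_mul, hij]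
  simp

theorem comm_bd (M D : Matrix (Fin n) (Fin n) ℝ) (hD : ∀ i j, blk i ≠ blk j → D i j = 0)
    (h : ∀ i j, blk i = blk j → (M * D - D * M) i j = 0) : bd blk M * D = D * bd blk M := by
  ext i j
  by_cases hij : blk i = blk j
  · have := h i j hij
    rw [Matrix.sub_apply, sub_eq_zero] at this
    have e1 : (bd blk M * D) i j = (M * D) i j := by
      rw [Matrix.mul_apply, Matrix.mul_apply]
      refine Finset.sum_congr rfl fun l _ => ?_
      by_cases hl : blk l = blk j
      · simp [bd, hij, hl]
      · rw [hD l j hl]; simp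
    have e2 : (D * bd blk M) i j = (D * M) i j := by
      rw [Matrix.mul_apply, Matrix.mul_apply]
      refine Finset.sum_congr rfl fun l _ => ?_
      by_cases hl : blk i = blk l
      · simp [bd, ← hij, hl]
      · rw [hD i l hl]; simp
    rw [e1, e2, this]
  · rw [Matrix.mul_apply, Matrix.mul_apply, Finset.sum_eq_zero, Finset.sum_eq_zero]
    · intro l _
      by_cases hl : blk i = blk l
      · have : blk l ≠ blk j := fun h => hij (hl.trans h)
        simp [bd, this]
      · rw [hD i l hl]; simp
    · intro l _
      by_cases hl : blk l = blk j
      · have : blk i ≠ blk l := fun h => hij (h.trans hl)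
        simp [bd, this]
      · rw [hD l j hl]; simp

theorem mem_span_HH (hmono : Monotone blk) (hα : Function.Injective α)
    (D : Matrix (Fin n) (Fin n) ℝ) (hD : ∀ i j, blk i ≠ blk j → D i j = 0)
    (h : ∀ i j, blk i = blk j → (M0 n * D - D * M0 n) i j = 0) :
    D ∈ Submodule.span ℝ (HH (diagonal fun i => α (blk i)) (M0 n)) := by
  have hcomm := comm_bd blk (M0 n) D hD h
  have key : ∀ p : Fin r, ∃ q : ℝ[X], ∀ j, blk j = p → D j = (aeval (bd blk (M0 n)) q) j := by
    intro p
    by_cases hp : ∃ m, ∃ j : Fin n, j.val = m ∧ blk j = p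
    · classical
      obtain ⟨s, hs1, hs2⟩ := Nat.find_spec hp
      have hmin : ∀ l : Fin n, blk l = p → s.val ≤ l.val := by
        intro l hl
        rw [hs1]
        exact Nat.find_min' hp ⟨l, rfl, hl⟩
      refine lemB (bd blk (M0 n)) (fun j => blk j = p) s ?_ D hcomm ?_
      · intro k hk
        refine lemB1 (bd blk (M0 n)) (fun j => blk j = p) s ?_ ?_ hmin ?_ k.val k rfl hk
        · intro j k hjk
          simp [bd, M0_hess j k hjk]
        · intro j k hj hk
          have : blk j ≠ blk k := fun h => hk (h.symm.trans hj)
          simp [bd, this]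
        · intro k hk hsk
          let j : Fin n := ⟨k.val - 1, by omega⟩
          have hjk : j.val + 1 = k.val := by simp [j]; omega
          have hj : blk j = p := by
            apply le_antisymm
            · rw [← hk]; exact hmono (Fin.le_def.2 (by omega))
            · rw [← hs2]; exact hmono (Fin.le_def.2 (by omega))
          refine ⟨j, hj, hjk, ?_⟩
          simp [bd, hj, hk, M0_sup j k hjk]
      · intro l hl
        exact hD s l fun h => hl (h.symm.trans hs2)
    · exact ⟨0, fun j hj => (hp ⟨_, j, rfl, hj⟩).elim⟩
  choose q hq using key
  have e : D = ∑ p, EE blk p * aeval (bd blk (M0 n)) (q p) := by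
    ext i j
    rw [Matrix.sum_apply]
    simp only [EE, diagonal_mul]
    simp [← hq (blk i) i rfl]
  rw [e]
  refine Submodule.sum_mem _ fun p _ => ?_
  rw [aeval_eq_sum_range, Finset.mul_sum]
  refine Submodule.sum_mem _ fun i _ => ?_
  rw [mul_smul_comm]
  exact Submodule.smul_mem _ _ (EE_mem blk α hα (M0 n) p i)

theorem exists_V (M D : Matrix (Fin n) (Fin n) ℝ) (m : ℕ)
    (hD : D ∈ Submodule.span ℝ (HH (diagonal fun i => α (blk i)) M)) :
    ∃ V : ℕ → Matrix (Fin n) (Fin n) ℝ, (∀ k, m < k → V k = 0) ∧ V m = D ∧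
      (∀ k, (M * V (k + 1) - V (k + 1) * M) + ((diagonal fun i => α (blk i)) * V k
        - V k * (diagonal fun i => α (blk i))) = 0) ∧
      V 0 ∈ Lt (diagonal fun i => α (blk i)) M ∧
      ∀ i j, blk i = blk j → (M * V 0 - V 0 * M) i j = 0 := by
  induction hD using Submodule.span_induction with
  | mem D hD =>
    obtain ⟨d, f, hd, rfl⟩ := hD
    set A : Matrix (Fin n) (Fin n) ℝ := diagonal fun i => α (blk i) with hA
    have hcm := comm_T A M (C (X ^ m) * f)
    have hP : aeval (TT A M) (C (X ^ m) * f) = (X ^ m : ℝ[X]) • aeval (TT A M) f := by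
      rw [map_mul, aeval_C, ← Algebra.smul_def]
    refine ⟨fun k => cf (k + d) (aeval (TT A M) (C (X ^ m) * f)), ?_, ?_, ?_, ?_, ?_⟩
    · intro k hk
      obtain ⟨c, rfl⟩ := Nat.exists_eq_add_of_lt hk
      dsimp only
      rw [hP, show m + c + 1 + d = (c + 1 + d) + m by omega, cf_Xpow_smul]
      exact hd.cf_zero (by omega)
    · dsimp only
      rw [hP, add_comm m d, cf_Xpow_smul]
    · intro k
      have := chain_succ A M _ hcm (k + d)
      rwa [show k + d + 1 = k + 1 + d by omega] at this
    · exact cf_mem_Lt _ _ _ _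
    · intro i j hij
      dsimp only
      rw [zero_add]
      cases d with
      | zero => rw [chain_zero A M _ hcm]; rfl
      | succ d =>
        rw [eq_neg_of_add_eq_zero_left (chain_succ A M _ hcm d), Matrix.neg_apply,
          comm_block blk α _ i j hij, neg_zero]
  | zero => exact ⟨0, by simp, by simp, by simp, by simp, by simp⟩
  | add D D' _ _ ih ih' =>
    obtain ⟨V, h1, h2, h3, h4, h5⟩ := ih
    obtain ⟨V', h1', h2', h3', h4', h5'⟩ := ih'
    refine ⟨V + V', ?_, ?_, ?_, ?_, ?_⟩
    · intro k hk; simp [h1 k hk, h1' k hk]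
    · simp [h2, h2']
    · intro k
      have := congrArg₂ (· + ·) (h3 k) (h3' k)
      simp only [add_zero] at this
      rw [← this]
      simp only [Pi.add_apply]
      noncomm_ring
    · exact add_mem h4 h4'
    · intro i j hij
      have e : M * (V + V') 0 - (V + V') 0 * M = (M * V 0 - V 0 * M) + (M * V' 0 - V' 0 * M) := by
        simp only [Pi.add_apply]; noncomm_ring
      rw [e, Matrix.add_apply, h5 i j hij, h5' i j hij, add_zero]
  | smul c D _ ih =>
    obtain ⟨V, h1, h2, h3, h4, h5⟩ := ih
    refine ⟨c • V, ?_, ?_, ?_, ?_, ?_⟩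
    · intro k hk; simp [h1 k hk]
    · simp [h2]
    · intro k
      have := congrArg (c • ·) (h3 k)
      simp only [smul_zero] at this
      rw [← this]
      simp only [Pi.smul_apply, mul_smul_comm, smul_mul_assoc, smul_add, smul_sub]
    · exact Submodule.smul_mem _ _ h4
    · intro i j hij
      have e : M * (c • V) 0 - (c • V) 0 * M = c • (M * V 0 - V 0 * M) := by
        simp only [Pi.smul_apply, mul_smul_comm, smul_mul_assoc, smul_sub]
      rw [e, Matrix.smul_apply, h5 i j hij, smul_zero]

theorem descend (hmono : Monotone blk) (hα : Function.Injective α) (m : ℕ) :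
    ∀ Z : ℕ → Matrix (Fin n) (Fin n) ℝ, (∀ k, m < k → Z k = 0) →
      (∀ k, (M0 n * Z (k + 1) - Z (k + 1) * M0 n) + ((diagonal fun i => α (blk i)) * Z k
        - Z k * (diagonal fun i => α (blk i))) = 0) →
      (∀ i j, blk i = blk j → (M0 n * Z 0 - Z 0 * M0 n) i j = 0) →
      Z 0 ∈ Lt (diagonal fun i => α (blk i)) (M0 n) := by
  induction m with
  | zero =>
    intro Z h1 h2 h3
    have hc := h2 0
    rw [h1 1 (by omega)] at hc
    simp only [mul_zero, zero_mul, sub_zero, zero_add] at hc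
    have hm := mem_span_HH blk α hmono hα (Z 0) (block_of_comm blk α hα _ hc) h3
    obtain ⟨V, -, v2, -, v4, -⟩ := exists_V blk α (M0 n) (Z 0) 0 hm
    rwa [← v2]
  | succ m ih =>
    intro Z h1 h2 h3
    have hc := h2 (m + 1)
    rw [h1 (m + 1 + 1) (by omega)] at hc
    simp only [mul_zero, zero_mul, sub_zero, zero_add] at hc
    have hm := mem_span_HH blk α hmono hα (Z (m + 1)) (block_of_comm blk α hα _ hc) (by
      intro i j hij
      rw [eq_neg_of_add_eq_zero_left (h2 m), Matrix.neg_apply,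
          comm_block blk α _ i j hij, neg_zero])
    obtain ⟨V, v1, v2, v3, v4, v5⟩ := exists_V blk α (M0 n) (Z (m + 1)) (m + 1) hm
    have := ih (Z - V) ?_ ?_ ?_
    · have := add_mem this v4
      simpa using this
    · intro k hk
      rcases (show m + 1 ≤ k by omega).eq_or_lt with rfl | hk'
      · simp [v2]
      · simp [h1 k hk', v1 k hk']
    · intro k
      have := congrArg₂ (· - ·) (h2 k) (v3 k)
      simp only [sub_zero] at this
      rw [← this]
      simp only [Pi.sub_apply]
      noncomm_ring
    · intro i j hij
      have e : M0 n * (Z - V) 0 - (Z - V) 0 * M0 n =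
          (M0 n * Z 0 - Z 0 * M0 n) - (M0 n * V 0 - V 0 * M0 n) := by
        simp only [Pi.sub_apply]; noncomm_ring
      rw [e, Matrix.sub_apply, h3 i j hij, v5 i j hij, sub_zero]

theorem eval_T (A M : Matrix (Fin n) (Fin n) ℝ) (t : ℝ) :
    (evalRingHom t).mapMatrix (TT A M) = M + t • A := by
  ext i j
  simp [TT]; ring

theorem trace_poly (A M Y : Matrix (Fin n) (Fin n) ℝ) (j : ℕ)
    (h : ∀ t : ℝ, (Y * (M + t • A) ^ j).trace = 0) : (Y.map C * TT A M ^ j).trace = 0 := by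
  refine Polynomial.funext fun t => ?_
  have e : (evalRingHom t).mapMatrix (Y.map C) = Y := by ext i j; simp
  have := h t
  rw [← eval_T, ← map_pow] at this
  nth_rewrite 1 [← e] at this
  rw [← map_mul] at this
  rw [eval_zero, ← this]
  simp only [Matrix.trace, Matrix.diag, eval_finsetSum, RingHom.mapMatrix_apply, Matrix.map_apply,
    coe_evalRingHom]

theorem trace_cf (A M Y : Matrix (Fin n) (Fin n) ℝ) (j k : ℕ)
    (h : ∀ t : ℝ, (Y * (M + t • A) ^ j).trace = 0) : (Y * cf k (TT A M ^ j)).trace = 0 := by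
  have := congrArg (fun p => coeff p k) (trace_poly A M Y j h)
  rw [← cf_Cmul]
  simpa [Matrix.trace, finsetSum_coeff, cf_apply] using this

theorem skew_zero (ξ : Matrix (Fin n) (Fin n) ℝ) (h : ξᵀ = -ξ) (h2 : (ξ * ξ).trace = 0) : ξ = 0 := by
  have : (ξᴴ * ξ).trace = 0 := by
    rw [conjTranspose_eq_transpose_of_trivial, h, neg_mul, trace_neg, h2, neg_zero]
  exact Matrix.trace_conjTranspose_mul_self_eq_zero_iff.1 this

theorem core (hmono : Monotone blk) (hα : Function.Injective α)
    (ξ : Matrix (Fin n) (Fin n) ℝ) (hξ : ξᵀ = -ξ)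
    (h1 : ∀ (t : ℝ) (j : ℕ), (ξ * (M0 n + t • (diagonal fun i => α (blk i))) ^ j).trace = 0)
    (h2 : ∀ (t : ℝ) (j : ℕ), ((M0 n * ξ - ξ * M0 n) *
      (M0 n + t • (diagonal fun i => α (blk i))) ^ j).trace = 0)
    (h3 : ∀ η ∈ soA (diagonal fun i => α (blk i)), ((M0 n * ξ - ξ * M0 n) * η).trace = 0) :
    ξ = 0 := by
  rcases Nat.eq_zero_or_pos n with rfl | hn
  · exact Subsingleton.elim _ _
  set A : Matrix (Fin n) (Fin n) ℝ := diagonal fun i => α (blk i) with hA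
  set Y := M0 n * ξ - ξ * M0 n with hY
  have hYs : Yᵀ = -Y := by
    rw [hY, transpose_sub, transpose_mul, transpose_mul, hξ, M0_skew]; noncomm_ring
  have hYb : ∀ i j, blk i = blk j → Y i j = 0 := by
    intro i j hij
    have := h3 (Matrix.single j i 1 - Matrix.single i j 1) (by
      constructor
      · simp [transpose_sub, transpose_single]
      · rw [hA]
        ext a b
        rw [mul_diagonal, diagonal_mul, mul_comm]
        by_cases hab : blk a = blk b
        · rw [hab]
        · have z1 : ¬ (j = a ∧ i = b) := by rintro ⟨rfl, rfl⟩; exact hab hij.symm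
          have z2 : ¬ (i = a ∧ j = b) := by rintro ⟨rfl, rfl⟩; exact hab hij
          simp [Matrix.single_apply, z1, z2])
    have e2 : Y j i = - Y i j := by
      have := congrFun (congrFun hYs i) j
      simpa using this
    rw [Matrix.mul_sub, trace_sub, Matrix.trace_mul_single, Matrix.trace_mul_single] at this
    simp [e2] at this
    linarith
  let z : Fin n := ⟨0, hn⟩
  have hT : ∀ j k : Fin n, j.val + 1 ≤ k.val → TT A (M0 n) j k = C (M0 n j k) := by
    intro j k hjk
    have : j ≠ k := by rintro rfl; omega
    simp [TT, hA, this]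
  obtain ⟨Z, hZ⟩ := lemA (TT A (M0 n))
    (fun j k h => by rw [hT j k h.le, M0_hess j k h, C_0])
    (fun j k h => by rw [hT j k h.le, M0_sup j k h, C_1]; exact isUnit_one) z rfl (Y.map C)
    (fun i => trace_poly A (M0 n) Y i fun t => h2 t i)
  have hY0 : M0 n * cf 0 Z - cf 0 Z * M0 n = Y := by
    have := congrArg (cf 0) hZ
    rw [map_sub, cf_T_mul_zero, cf_mul_T_zero] at this
    rw [← this]; ext i j; simp [cf_apply]
  have hZk : ∀ k, (M0 n * cf (k + 1) Z - cf (k + 1) Z * M0 n) + (A * cf k Z - cf k Z * A) = 0 := by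
    intro k
    have := congrArg (cf (k + 1)) hZ
    rw [map_sub, cf_T_mul_succ, cf_mul_T_succ] at this
    have e : cf (k + 1) (Y.map C) = 0 := by ext i j; simp [cf_apply, coeff_C]
    rw [e] at this
    rw [this]; abel
  have hcent : M0 n * (cf 0 Z - ξ) = (cf 0 Z - ξ) * M0 n := by
    have : M0 n * cf 0 Z - cf 0 Z * M0 n = M0 n * ξ - ξ * M0 n := hY0.trans hY
    rw [← sub_eq_zero] at this ⊢
    rw [← this]; noncomm_ring
  obtain ⟨q, hq⟩ := lemB (M0 n) (fun _ => True) z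
    (fun k _ => lemB1 (M0 n) (fun _ => True) z M0_hess (by simp) (by simp [z])
      (fun k _ hk => ⟨⟨k.val - 1, by omega⟩, trivial, by simp [z] at hk ⊢; omega, by
        rw [M0_sup _ _ (by simp [z] at hk ⊢; omega)]; exact isUnit_one⟩) k.val k rfl trivial)
    (cf 0 Z - ξ) hcent (by simp)
  have hq' : cf 0 Z - ξ = aeval (M0 n) q := by
    ext i j; exact congrFun (hq i trivial) j
  set Q := aeval (TT A (M0 n)) (q.map C) with hQ
  have hQ0 : cf 0 Q = aeval (M0 n) q := by
    rw [hQ]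
    have e0 : ∀ P : Matrix (Fin n) (Fin n) ℝ[X], cf 0 P = (evalRingHom (0 : ℝ)).mapMatrix P := by
      intro P; ext i j; simp [cf_apply, coeff_zero_eq_eval_zero]
    rw [aeval_eq_sum_range, aeval_eq_sum_range, map_sum,
      natDegree_map_eq_of_injective (C_injective)]
    refine Finset.sum_congr rfl fun i _ => ?_
    rw [coeff_map]
    have e1 : (C (q.coeff i) : ℝ[X]) • TT A (M0 n) ^ i = q.coeff i • TT A (M0 n) ^ i := by
      ext1 a b; simp [Matrix.smul_apply, smul_eq_C_mul]
    rw [e1, map_smul, e0, map_pow, eval_T, zero_smul, add_zero]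
  have hQk := chain_succ A (M0 n) Q (comm_T A (M0 n) _)
  have hZQ0 : cf 0 (Z - Q) = ξ := by
    rw [map_sub, hQ0, ← hq']; abel
  obtain ⟨m, hm⟩ := exists_DB (Z - Q)
  have hL := descend blk α hmono hα m (fun k => cf k (Z - Q)) (fun k hk => hm.cf_zero hk) (by
      intro k
      have := congrArg₂ (· - ·) (hZk k) (hQk k)
      simp only [sub_zero] at this
      rw [← this, map_sub, map_sub]
      noncomm_ring) (by
      intro i j hij
      rw [hZQ0]; exact hYb i j hij)
  rw [hZQ0] at hL
  refine skew_zero ξ hξ ?_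
  have : ∀ P ∈ Lt A (M0 n), (ξ * P).trace = 0 := by
    intro P hP
    induction hP using Submodule.span_induction with
    | mem P hP =>
      obtain ⟨k, j, rfl⟩ := hP
      exact trace_cf A (M0 n) ξ j k fun t => h1 t j
    | zero => simp
    | add P Q _ _ hP hQ => rw [mul_add, trace_add, hP, hQ, add_zero]
    | smul c P _ hP => rw [mul_smul_comm, trace_smul, hP, smul_zero]
  exact this ξ hL
end core
end Mnk

namespace Mnk
open Polynomial

section final
variable {n : ℕ}

theorem tr_comm_left {T X Y : Matrix (Fin n) (Fin n) ℝ} (h : Commute T X) :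
    (T * (X * Y - Y * X)).trace = 0 := by
  rw [mul_sub, trace_sub, ← mul_assoc, h.eq, mul_assoc, trace_mul_comm, mul_assoc, sub_self]

theorem tr_comm_right {T X Y : Matrix (Fin n) (Fin n) ℝ} (h : Commute T Y) :
    (T * (X * Y - Y * X)).trace = 0 := by
  have := tr_comm_left (Y := X) h
  rw [← neg_sub, mul_neg, trace_neg, this, neg_zero]

theorem tr_split (A M Q : Matrix (Fin n) (Fin n) ℝ) (t : ℝ) :
    ((M + t • A) * Q).trace = (M * Q).trace + t * (A * Q).trace := by
  rw [add_mul, trace_add, smul_mul_assoc, trace_smul, smul_eq_mul]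

theorem inv0 (A M : Matrix (Fin n) (Fin n) ℝ) (s t : ℝ) (i j : ℕ) :
    (M * ((M + s • A) ^ i * (M + t • A) ^ j - (M + t • A) ^ j * (M + s • A) ^ i)).trace = 0 := by
  by_cases hst : s = t
  · subst hst
    rw [← pow_add, ← pow_add, add_comm j i, sub_self, mul_zero, trace_zero]
  · have h1 := tr_comm_left (Y := (M + t • A) ^ j) (Commute.self_pow (M + s • A) i)
    have h2 := tr_comm_right (X := (M + s • A) ^ i) (Commute.self_pow (M + t • A) j)
    rw [tr_split] at h1 h2
    set c := (A * ((M + s • A) ^ i * (M + t • A) ^ j - (M + t • A) ^ j * (M + s • A) ^ i)).trace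
    have h3 : (s - t) * c = 0 := by linarith
    have hc : c = 0 := (mul_eq_zero.1 h3).resolve_left (sub_ne_zero.2 hst)
    rw [hc] at h1; linarith

theorem inv1 (A M η : Matrix (Fin n) (Fin n) ℝ) (hη : η * A = A * η) (s : ℝ) (i : ℕ) :
    (M * ((M + s • A) ^ i * η - η * (M + s • A) ^ i)).trace = 0 := by
  have h1 := tr_comm_left (Y := η) (Commute.self_pow (M + s • A) i)
  have h2 : (A * ((M + s • A) ^ i * η - η * (M + s • A) ^ i)).trace = 0 := tr_comm_right hη.symm
  rw [tr_split, h2] at h1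
  linarith

theorem skewPart_pow (A M : Matrix (Fin n) (Fin n) ℝ) (hA : Aᵀ = A) (hM : Mᵀ = -M) (s : ℝ) (i : ℕ) :
    skewPart ((M + s • A) ^ i) =
      (1 / 2 : ℝ) • ((M + s • A) ^ i - (-1 : ℝ) ^ i • (M + (-s) • A) ^ i) := by
  rw [skewPart, transpose_pow, transpose_add, transpose_smul, hA, hM, ← _root_.smul_pow]
  congr 3
  module

theorem invol (A M : Matrix (Fin n) (Fin n) ℝ) (hA : Aᵀ = A) (hM : Mᵀ = -M)
    (l g : Matrix (Fin n) (Fin n) ℝ) (hl : l ∈ Submodule.span ℝ (manakovGradients A M))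
    (hg : g ∈ Submodule.span ℝ (manakovGradients A M) ⊔ Submodule.span ℝ (soA A)) :
    (M * (l * g - g * l)).trace = 0 := by
  have add2 : ∀ l g g' : Matrix (Fin n) (Fin n) ℝ, (M * (l * g - g * l)).trace = 0 →
      (M * (l * g' - g' * l)).trace = 0 → (M * (l * (g + g') - (g + g') * l)).trace = 0 := by
    intro l g g' h h'
    have : M * (l * (g + g') - (g + g') * l) = M * (l * g - g * l) + M * (l * g' - g' * l) := by
      noncomm_ring
    rw [this, trace_add, h, h', add_zero]
  have smul2 : ∀ (c : ℝ) (l g : Matrix (Fin n) (Fin n) ℝ), (M * (l * g - g * l)).trace = 0 →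
      (M * (l * (c • g) - (c • g) * l)).trace = 0 := by
    intro c l g h
    rw [mul_smul_comm, smul_mul_assoc, ← smul_sub, mul_smul_comm, trace_smul, h, smul_zero]
  have flip : ∀ l g : Matrix (Fin n) (Fin n) ℝ, (M * (l * g - g * l)).trace = 0 →
      (M * (g * l - l * g)).trace = 0 := by
    intro l g h
    rw [← neg_sub, mul_neg, trace_neg, h, neg_zero]
  rw [← Submodule.span_union] at hg
  have half : ∀ g : Matrix (Fin n) (Fin n) ℝ, (∀ (s : ℝ) (i : ℕ),
      (M * ((M + s • A) ^ i * g - g * (M + s • A) ^ i)).trace = 0) →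
      ∀ (s : ℝ) (i : ℕ), (M * (skewPart ((M + s • A) ^ i) * g - g * skewPart ((M + s • A) ^ i))).trace = 0 := by
    intro g h s i
    rw [skewPart_pow A M hA hM]
    apply flip
    apply smul2
    rw [sub_eq_add_neg ((M + s • A) ^ i), ← neg_smul]
    apply add2
    · exact flip _ _ (h s i)
    · exact smul2 _ _ _ (flip _ _ (h _ i))
  induction hl using Submodule.span_induction with
  | mem l hl =>
    obtain ⟨s, i, rfl⟩ := hl
    induction hg using Submodule.span_induction with
    | mem g hg =>
      apply half
      rcases hg with ⟨t, j, rfl⟩ | hg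
      · intro s' i'
        apply flip
        exact half _ (fun s'' i'' => inv0 A M _ _ _ _) t j
      · intro s' i'
        exact inv1 A M g hg.2 s' i'
    | zero => simp
    | add g g' _ _ h h' => exact add2 _ _ _ h h'
    | smul c g _ h => exact smul2 _ _ _ h
  | zero => simp
  | add l l' _ _ h h' => exact flip _ _ (add2 _ _ _ (flip _ _ h) (flip _ _ h'))
  | smul c l _ h => exact flip _ _ (smul2 _ _ _ (flip _ _ h))

/-- continuous maps, polynomial on lines -/
def PL (F : Matrix (Fin n) (Fin n) ℝ → Matrix (Fin n) (Fin n) ℝ) : Prop :=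
  Continuous F ∧ ∀ M N, ∃ P : Matrix (Fin n) (Fin n) ℝ[X],
    ∀ t : ℝ, F (M + t • N) = (evalRingHom t).mapMatrix P

theorem eval_mapC (Q : Matrix (Fin n) (Fin n) ℝ) (t : ℝ) :
    (evalRingHom t).mapMatrix (Q.map C) = Q := by ext i j; simp

theorem PL_const (Q : Matrix (Fin n) (Fin n) ℝ) : PL fun _ => Q :=
  ⟨continuous_const, fun _ _ => ⟨Q.map C, fun t => (eval_mapC Q t).symm⟩⟩

theorem PL_id : PL fun M : Matrix (Fin n) (Fin n) ℝ => M :=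
  ⟨continuous_id, fun M N => ⟨TT N M, fun t => (eval_T N M t).symm⟩⟩

theorem PL.add {F F' : Matrix (Fin n) (Fin n) ℝ → Matrix (Fin n) (Fin n) ℝ} (h : PL F) (h' : PL F') :
    PL fun M => F M + F' M := by
  refine ⟨h.1.add h'.1, fun M N => ?_⟩
  obtain ⟨P, hP⟩ := h.2 M N
  obtain ⟨P', hP'⟩ := h'.2 M N
  exact ⟨P + P', fun t => by beta_reduce; rw [map_add, hP, hP']⟩

theorem PL.sub {F F' : Matrix (Fin n) (Fin n) ℝ → Matrix (Fin n) (Fin n) ℝ} (h : PL F) (h' : PL F') :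
    PL fun M => F M - F' M := by
  refine ⟨h.1.sub h'.1, fun M N => ?_⟩
  obtain ⟨P, hP⟩ := h.2 M N
  obtain ⟨P', hP'⟩ := h'.2 M N
  exact ⟨P - P', fun t => by beta_reduce; rw [map_sub, hP, hP']⟩

theorem PL.mul {F F' : Matrix (Fin n) (Fin n) ℝ → Matrix (Fin n) (Fin n) ℝ} (h : PL F) (h' : PL F') :
    PL fun M => F M * F' M := by
  refine ⟨h.1.mul h'.1, fun M N => ?_⟩
  obtain ⟨P, hP⟩ := h.2 M N
  obtain ⟨P', hP'⟩ := h'.2 M N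
  exact ⟨P * P', fun t => by beta_reduce; rw [map_mul, hP, hP']⟩

theorem PL.pow {F : Matrix (Fin n) (Fin n) ℝ → Matrix (Fin n) (Fin n) ℝ} (h : PL F) (k : ℕ) :
    PL fun M => F M ^ k := by
  refine ⟨h.1.pow k, fun M N => ?_⟩
  obtain ⟨P, hP⟩ := h.2 M N
  exact ⟨P ^ k, fun t => by beta_reduce; rw [map_pow, hP]⟩

theorem PL.skew {F : Matrix (Fin n) (Fin n) ℝ → Matrix (Fin n) (Fin n) ℝ} (h : PL F) :
    PL fun M => skewPart (F M) := by
  refine ⟨?_, fun M N => ?_⟩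
  · unfold skewPart
    exact Continuous.const_smul (h.1.sub h.1.matrix_transpose) (1 / 2 : ℝ)
  · obtain ⟨P, hP⟩ := h.2 M N
    refine ⟨(C (1 / 2 : ℝ)) • (P - Pᵀ), fun t => ?_⟩
    beta_reduce
    rw [hP]
    ext i j
    simp [skewPart]

/-- the family of polynomial maps -/
def FF (A : Matrix (Fin n) (Fin n) ℝ) : Set (Matrix (Fin n) (Fin n) ℝ → Matrix (Fin n) (Fin n) ℝ) :=
  {F | (∃ (t : ℝ) (j : ℕ), F = fun M => skewPart ((M + t • A) ^ j)) ∨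
    (∃ (t : ℝ) (j : ℕ), F = fun M => M * skewPart ((M + t • A) ^ j) - skewPart ((M + t • A) ^ j) * M) ∨
    (∃ η ∈ soA A, F = fun M => M * η - η * M) ∨
    (∃ S : Matrix (Fin n) (Fin n) ℝ, Sᵀ = S ∧ F = fun _ => S)}

theorem FF_PL (A : Matrix (Fin n) (Fin n) ℝ) (F) (hF : F ∈ FF A) : PL F := by
  have h : ∀ (t : ℝ) (j : ℕ), PL fun M => skewPart ((M + t • A) ^ j) := fun t j =>
    ((PL_id.add (PL_const (t • A))).pow j).skew
  rcases hF with ⟨t, j, rfl⟩ | ⟨t, j, rfl⟩ | ⟨η, -, rfl⟩ | ⟨S, -, rfl⟩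
  · exact h t j
  · exact (PL_id.mul (h t j)).sub ((h t j).mul PL_id)
  · exact (PL_id.mul (PL_const η)).sub ((PL_const η).mul PL_id)
  · exact PL_const S

theorem tr_skewPart (ξ P : Matrix (Fin n) (Fin n) ℝ) (hξ : ξᵀ = -ξ) :
    (ξ * skewPart P).trace = (ξ * P).trace := by
  have : (ξ * Pᵀ).trace = - (ξ * P).trace := by
    rw [← trace_transpose, transpose_mul, transpose_transpose, hξ, mul_neg, trace_neg, trace_mul_comm]
  rw [skewPart, mul_smul_comm, trace_smul, mul_sub, trace_sub, this, smul_eq_mul]; ring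

theorem tr_move (M ξ η : Matrix (Fin n) (Fin n) ℝ) :
    (ξ * (M * η - η * M)).trace = - ((M * ξ - ξ * M) * η).trace := by
  have : (ξ * (η * M)).trace = (M * ξ * η).trace := by
    rw [← mul_assoc, trace_mul_comm, mul_assoc]
  rw [mul_sub, sub_mul, trace_sub, trace_sub, this, mul_assoc ξ M η]; ring

theorem tr_move' (M ξ η : Matrix (Fin n) (Fin n) ℝ) :
    (ξ * (M * η - η * M)).trace = - (M * (ξ * η - η * ξ)).trace := by
  rw [tr_move, sub_mul, mul_sub, trace_sub, trace_sub, mul_assoc M ξ η,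
    mul_assoc ξ M η, trace_mul_comm ξ, mul_assoc M η ξ]

theorem span_M0 {r : ℕ} (blk : Fin n → Fin r) (α : Fin r → ℝ) (hmono : Monotone blk)
    (hα : Function.Injective α) :
    Submodule.span ℝ ((fun F => F (M0 n)) '' FF (diagonal fun i => α (blk i))) = ⊤ := by
  set A : Matrix (Fin n) (Fin n) ℝ := diagonal fun i => α (blk i) with hA
  by_contra hne
  obtain ⟨f, hf, hle⟩ := Submodule.exists_le_ker_of_lt_top _ (lt_top_iff_ne_top.2 hne)
  let ξ : Matrix (Fin n) (Fin n) ℝ := Matrix.of fun i j => f (Matrix.single j i 1)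
  have hfξ : ∀ P, f P = (ξ * P).trace := by
    intro P
    conv_lhs => rw [matrix_eq_sum_single P]
    rw [map_sum, Matrix.trace_mul_comm, Matrix.trace]
    refine Finset.sum_congr rfl fun i _ => ?_
    rw [map_sum, Matrix.diag_apply, Matrix.mul_apply]
    refine Finset.sum_congr rfl fun j _ => ?_
    have : Matrix.single i j (P i j) = P i j • Matrix.single i j (1 : ℝ) := by simp
    rw [this, map_smul]; rfl
  have hz : ∀ F ∈ FF A, (ξ * F (M0 n)).trace = 0 := by
    intro F hF
    rw [← hfξ]
    exact hle (Submodule.subset_span ⟨F, hF, rfl⟩)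
  have hξ : ξᵀ = -ξ := by
    ext i j
    have := hz _ (Or.inr (Or.inr (Or.inr ⟨Matrix.single i j 1 + Matrix.single j i 1, by
      simp [transpose_add, transpose_single, add_comm], rfl⟩)))
    rw [mul_add, trace_add, Matrix.trace_mul_single, Matrix.trace_mul_single] at this
    rw [transpose_apply, Matrix.neg_apply]
    simp at this
    linarith
  have h0 : ξ = 0 := by
    refine core blk α hmono hα ξ hξ ?_ ?_ ?_
    · intro t j
      rw [← tr_skewPart _ _ hξ]
      exact hz _ (Or.inl ⟨t, j, rfl⟩)
    · intro t j
      have hs : (M0 n * ξ - ξ * M0 n)ᵀ = -(M0 n * ξ - ξ * M0 n) := by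
        rw [transpose_sub, transpose_mul, transpose_mul, hξ, M0_skew]; noncomm_ring
      rw [← tr_skewPart _ _ hs]
      have := hz _ (Or.inr (Or.inl ⟨t, j, rfl⟩))
      rw [tr_move] at this
      linarith
    · intro η hη
      have := hz _ (Or.inr (Or.inr (Or.inl ⟨η, hη, rfl⟩)))
      rw [tr_move] at this
      linarith
  apply hf
  ext1 P
  rw [hfξ, h0]; simp

theorem exists_det (A M₀ : Matrix (Fin n) (Fin n) ℝ)
    (h : Submodule.span ℝ ((fun F => F M₀) '' FF A) = ⊤) :
    ∃ W : Fin n × Fin n → (Matrix (Fin n) (Fin n) ℝ → Matrix (Fin n) (Fin n) ℝ),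
      (∀ i, W i ∈ FF A) ∧
      (Matrix.of fun (i k : Fin n × Fin n) => W i M₀ k.1 k.2).det ≠ 0 := by
  obtain ⟨w, hw, -, hli⟩ := Submodule.exists_fun_fin_finrank_span_eq ℝ ((fun F => F M₀) '' FF A)
  have hd : Module.finrank ℝ (Submodule.span ℝ ((fun F => F M₀) '' FF A)) = n * n := by
    rw [h, finrank_top, Module.finrank_matrix]; simp
  have e : Fin n × Fin n ≃ Fin (Module.finrank ℝ (Submodule.span ℝ ((fun F => F M₀) '' FF A))) :=
    Fintype.equivOfCardEq (by simp [hd])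
  choose G hG hGw using hw
  refine ⟨fun i => G (e i), fun i => hG _, ?_⟩
  let vec : Matrix (Fin n) (Fin n) ℝ →ₗ[ℝ] (Fin n × Fin n → ℝ) :=
    { toFun := fun P k => P k.1 k.2, map_add' := fun _ _ => rfl, map_smul' := fun _ _ => rfl }
  have hvec : LinearMap.ker vec = ⊥ := by
    rw [LinearMap.ker_eq_bot]
    intro P Q hPQ
    ext i j
    exact congrFun hPQ (i, j)
  have h1 := (hli.comp e e.injective).map' vec hvec
  have h2 : (vec ∘ w ∘ e) = (Matrix.of fun (i k : Fin n × Fin n) => G (e i) M₀ k.1 k.2).row := by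
    ext i k
    simp only [Function.comp, ← hGw]
    rfl
  rw [h2, linearIndependent_rows_iff_isUnit, isUnit_iff_isUnit_det] at h1
  exact h1.ne_zero

theorem span_of_det (A M : Matrix (Fin n) (Fin n) ℝ)
    (W : Fin n × Fin n → (Matrix (Fin n) (Fin n) ℝ → Matrix (Fin n) (Fin n) ℝ))
    (hdet : (Matrix.of fun (i k : Fin n × Fin n) => W i M k.1 k.2).det ≠ 0)
    (S : Submodule ℝ (Matrix (Fin n) (Fin n) ℝ)) (hS : ∀ i, W i M ∈ S)
    (P : Matrix (Fin n) (Fin n) ℝ) : P ∈ S := by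
  set D := Matrix.of fun (i k : Fin n × Fin n) => W i M k.1 k.2 with hD
  let x : Fin n × Fin n → ℝ := fun k => P k.1 k.2
  have e : P = ∑ i, (x ᵥ* D⁻¹) i • W i M := by
    ext a b
    have : (x ᵥ* D⁻¹) ᵥ* D = x := by
      rw [vecMul_vecMul, nonsing_inv_mul _ (Ne.isUnit hdet), vecMul_one]
    have := congrFun this (a, b)
    rw [Matrix.sum_apply]
    simp only [Matrix.smul_apply, smul_eq_mul]
    exact this.symm
  rw [e]
  exact S.sum_mem fun i _ => S.smul_mem _ (hS i)

theorem coiso (A M : Matrix (Fin n) (Fin n) ℝ) (hA : Aᵀ = A) (hM : Mᵀ = -M)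
    (W : Fin n × Fin n → (Matrix (Fin n) (Fin n) ℝ → Matrix (Fin n) (Fin n) ℝ))
    (hW : ∀ i, W i ∈ FF A)
    (hdet : (Matrix.of fun (i k : Fin n × Fin n) => W i M k.1 k.2).det ≠ 0)
    (ξ : Matrix (Fin n) (Fin n) ℝ) (hξ : ξᵀ = -ξ)
    (h : ∀ η ∈ Submodule.span ℝ (manakovGradients A M) ⊔ Submodule.span ℝ (soA A),
      (M * (ξ * η - η * ξ)).trace = 0) :
    ξ ∈ Submodule.span ℝ (manakovGradients A M) := by
  set L := Submodule.span ℝ (manakovGradients A M) with hL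
  set G := L ⊔ Submodule.span ℝ (soA A) with hG
  let ad : Matrix (Fin n) (Fin n) ℝ →ₗ[ℝ] Matrix (Fin n) (Fin n) ℝ :=
    LinearMap.mulLeft ℝ M - LinearMap.mulRight ℝ M
  let Sy : Submodule ℝ (Matrix (Fin n) (Fin n) ℝ) :=
    { carrier := {S | Sᵀ = S}
      add_mem' := by intro a b ha hb; simp only [Set.mem_ofPred_eq] at *; rw [transpose_add, ha, hb]
      zero_mem' := transpose_zero
      smul_mem' := by intro c a ha; simp only [Set.mem_ofPred_eq] at *; rw [transpose_smul, ha] }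
  have key : ξ ∈ L ⊔ (G.map ad ⊔ Sy) := by
    refine span_of_det A M W hdet _ (fun i => ?_) ξ
    have hl : ∀ (t : ℝ) (j : ℕ), skewPart ((M + t • A) ^ j) ∈ L :=
      fun t j => Submodule.subset_span ⟨t, j, rfl⟩
    rcases hW i with ⟨t, j, e⟩ | ⟨t, j, e⟩ | ⟨η, hη, e⟩ | ⟨S, hS, e⟩
    · rw [e]; exact Submodule.mem_sup_left (hl t j)
    · rw [e]
      exact Submodule.mem_sup_right (Submodule.mem_sup_left
        ⟨_, (Submodule.mem_sup_left (hl t j) : _ ∈ G), rfl⟩)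
    · rw [e]
      exact Submodule.mem_sup_right (Submodule.mem_sup_left
        ⟨η, (Submodule.mem_sup_right (Submodule.subset_span hη) : _ ∈ G), rfl⟩)
    · rw [e]; exact Submodule.mem_sup_right (Submodule.mem_sup_right hS)
  obtain ⟨l, hl, w, hw, rfl⟩ := Submodule.mem_sup.1 key
  have hls : lᵀ = -l := by
    clear h key hξ
    rw [hL] at hl
    induction hl using Submodule.span_induction with
    | mem P hP =>
      obtain ⟨t, j, rfl⟩ := hP
      rw [skewPart, transpose_smul, transpose_sub, transpose_transpose, ← smul_neg, neg_sub]
    | zero => simp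
    | add P Q _ _ hP hQ => rw [transpose_add, hP, hQ]; abel
    | smul c P _ hP => rw [transpose_smul, hP, smul_neg]
  have hws : wᵀ = -w := by
    rw [transpose_add, hls] at hξ
    have : wᵀ = -(l + w) + l := by rw [← hξ]; abel
    rw [this]; abel
  have hw0 : w = 0 := by
    refine skew_zero w hws ?_
    obtain ⟨_, ⟨g, hg, rfl⟩, S, hS, hgs⟩ := Submodule.mem_sup.1 hw
    nth_rewrite 2 [← hgs]
    rw [mul_add, trace_add]
    have t1 : (w * ad g).trace = 0 := by
      change (w * (M * g - g * M)).trace = 0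
      rw [tr_move']
      have a1 := h g hg
      have a2 := invol A M hA hM l g hl hg
      have : M * ((l + w) * g - g * (l + w)) = M * (l * g - g * l) + M * (w * g - g * w) := by
        noncomm_ring
      rw [this, trace_add, a2, zero_add] at a1
      rw [a1, neg_zero]
    have t2 : (w * S).trace = 0 := by
      have hS' : Sᵀ = S := hS
      have : (w * S).trace = - (w * S).trace := by
        conv_lhs => rw [← trace_transpose, transpose_mul, hws, hS', mul_neg, trace_neg, trace_mul_comm]
      linarith
    rw [t1, t2, add_zero]
  rw [hw0, add_zero]; exact hl

end final
end Mnk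

/-- Theorem 1 of the paper: Let `A` be the block-scalar diagonal matrix
with pairwise distinct values `α p` on consecutive blocks of sizes `k 1, …, k r`.
For `M ∈ so(n)` let `G_M = L_M + so(n)_A`, where `L_M` is the span of the gradients
`π((M + λA)^j)` of the Manakov integrals. Then there is an open dense subset `U` of
`so(n)` such that for every `M ∈ U` the subspace `G_M` is coisotropic for the
Lie–Poisson structure at `M`: every `ξ ∈ so(n)` with `tr(M·[ξ, η]) = 0` for all
`η ∈ G_M` belongs to `G_M`. -/
theorem manakov_plus_noether_complete (n r : ℕ) (k : Fin r → ℕ)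
    (hk : ∀ p, 0 < k p) (hsum : ∑ p, k p = n)
    (blk : Fin n → Fin r) (hmono : Monotone blk)
    (hcard : ∀ p, (Finset.univ.filter fun i => blk i = p).card = k p)
    (α : Fin r → ℝ) (hα : Function.Injective α)
    (A : Matrix (Fin n) (Fin n) ℝ) (hA : A = Matrix.diagonal fun i => α (blk i))
    (G : Matrix (Fin n) (Fin n) ℝ → Submodule ℝ (Matrix (Fin n) (Fin n) ℝ))
    (hG : ∀ M, G M = Submodule.span ℝ (manakovGradients A M) ⊔ Submodule.span ℝ (soA A)) :
    ∃ U : Set {X : Matrix (Fin n) (Fin n) ℝ // Xᵀ = -X},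
      IsOpen U ∧ Dense U ∧
      ∀ M ∈ U, ∀ ξ : Matrix (Fin n) (Fin n) ℝ, ξᵀ = -ξ →
        (∀ η ∈ G M.1, ((M.1 : Matrix (Fin n) (Fin n) ℝ) * (ξ * η - η * ξ)).trace = 0) →
        ξ ∈ G M.1 := by
  classical
  have hAt : Aᵀ = A := by rw [hA, diagonal_transpose]
  have hspan := Mnk.span_M0 blk α hmono hα
  rw [← hA] at hspan
  obtain ⟨W, hW, hdet⟩ := Mnk.exists_det A (Mnk.M0 n) hspan
  let D : Matrix (Fin n) (Fin n) ℝ → ℝ := fun M =>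
    (Matrix.of fun (i k : Fin n × Fin n) => W i M k.1 k.2).det
  have hDc : Continuous D := by
    refine Continuous.matrix_det ?_
    refine continuous_matrix fun i k => ?_
    exact ((Mnk.FF_PL A (W i) (hW i)).1).matrix_elem k.1 k.2
  refine ⟨{M | D M.1 ≠ 0}, ?_, ?_, ?_⟩
  · exact isOpen_ne.preimage (hDc.comp continuous_subtype_val)
  · intro M
    have hP : ∀ i, ∃ P : Matrix (Fin n) (Fin n) (Polynomial ℝ), ∀ t : ℝ,
        W i (M.1 + t • (Mnk.M0 n - M.1)) = (Polynomial.evalRingHom t).mapMatrix P :=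
      fun i => (Mnk.FF_PL A (W i) (hW i)).2 _ _
    choose P hP using hP
    let p : Polynomial ℝ := (Matrix.of fun (i k : Fin n × Fin n) => P i k.1 k.2).det
    have hp : ∀ t : ℝ, D (M.1 + t • (Mnk.M0 n - M.1)) = p.eval t := by
      intro t
      change _ = Polynomial.evalRingHom t p
      rw [RingHom.map_det]
      simp only [D, hP]
      rfl
    have hp0 : p ≠ 0 := by
      intro h0
      apply hdet
      have := hp 1
      rw [h0, Polynomial.eval_zero, one_smul, add_sub_cancel] at this
      exact this
    have hdense : Dense {t : ℝ | p.eval t ≠ 0} := by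
      have hfin : Set.Finite {t : ℝ | p.eval t = 0} := by
        refine (p.roots.toFinset.finite_toSet).subset fun t ht => ?_
        simp only [Finset.mem_coe, Multiset.mem_toFinset, Polynomial.mem_roots hp0]
        exact ht
      exact hfin.countable.dense_compl ℝ
    let γ : ℝ → {X : Matrix (Fin n) (Fin n) ℝ // Xᵀ = -X} := fun t =>
      ⟨M.1 + t • (Mnk.M0 n - M.1), by
        rw [transpose_add, transpose_smul, transpose_sub, Mnk.M0_skew, M.2]; module⟩
    have hγ : Continuous γ := by
      refine Continuous.subtype_mk ?_ _
      exact continuous_const.add (continuous_id.smul continuous_const)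
    have h0 : γ 0 = M := Subtype.ext (by simp [γ])
    rw [← h0]
    refine map_mem_closure hγ (hdense 0) fun t ht => ?_
    change D (M.1 + t • (Mnk.M0 n - M.1)) ≠ 0
    rw [hp]; exact ht
  · intro M hM ξ hξ h
    rw [hG] at h ⊢
    exact Submodule.mem_sup_left (Mnk.coiso A M.1 hAt M.2 W hW hM ξ hξ h)
end

section
/- For M ∈ so(n) let L_M be the real linear span of the matrices π((M + λA)^j) for λ ∈ ℝ and j ∈ ℕ. Then there is an open dense subset U ⊆ so(n) such that for every M ∈ U the skew-orthogonal complement of L_M with respect to the Lie–Poisson structure at M equals L_M + so(n)_A: {ξ ∈ so(n) : tr(M·[ξ, η]) = 0 for all η ∈ L_M} = L_M + so(n)_A. (Remark 1 of the paper.) -/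
open Matrix

open Polynomial in
/-- Coefficient of `τ^s` in `f(A + τ M)`. -/
noncomputable def wordCoeff {n : ℕ} (A M : Matrix (Fin n) (Fin n) ℝ) (s : ℕ) (f : ℝ[X]) :
    Matrix (Fin n) (Fin n) ℝ :=
  (aeval (C A + C M * X : (Matrix (Fin n) (Fin n) ℝ)[X]) f).coeff s

section words
open Polynomial
variable {n : ℕ} (A M : Matrix (Fin n) (Fin n) ℝ)

lemma wordCoeff_add (s : ℕ) (f g : ℝ[X]) :
    wordCoeff A M s (f + g) = wordCoeff A M s f + wordCoeff A M s g := by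
  simp [wordCoeff]

lemma wordCoeff_sub (s : ℕ) (f g : ℝ[X]) :
    wordCoeff A M s (f - g) = wordCoeff A M s f - wordCoeff A M s g := by
  simp [wordCoeff]

lemma wordCoeff_smul (s : ℕ) (c : ℝ) (f : ℝ[X]) :
    wordCoeff A M s (c • f) = c • wordCoeff A M s f := by
  simp [wordCoeff]

lemma wordCoeff_X_mul_zero (f : ℝ[X]) :
    wordCoeff A M 0 (X * f) = A * wordCoeff A M 0 f := by
  simp only [wordCoeff, map_mul, aeval_X, add_mul, coeff_add, coeff_C_mul, mul_assoc]
  simp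

lemma wordCoeff_X_mul_succ (s : ℕ) (f : ℝ[X]) :
    wordCoeff A M (s + 1) (X * f) = M * wordCoeff A M s f + A * wordCoeff A M (s + 1) f := by
  simp only [wordCoeff, map_mul, aeval_X, add_mul, coeff_add, coeff_C_mul, mul_assoc, coeff_X_mul]
  abel

lemma wordCoeff_mul_X_zero (f : ℝ[X]) :
    wordCoeff A M 0 (X * f) = wordCoeff A M 0 f * A := by
  rw [mul_comm]
  simp only [wordCoeff, map_mul, aeval_X, mul_add, coeff_add, coeff_mul_C, ← mul_assoc]
  simp

lemma wordCoeff_mul_X_succ (s : ℕ) (f : ℝ[X]) :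
    wordCoeff A M (s + 1) (X * f) = wordCoeff A M s f * M + wordCoeff A M (s + 1) f * A := by
  rw [mul_comm]
  simp only [wordCoeff, map_mul, aeval_X, mul_add, coeff_add, coeff_mul_C, ← mul_assoc, coeff_mul_X]
  abel

lemma wordCoeff_one (s : ℕ) : wordCoeff A M s 1 = if s = 0 then 1 else 0 := by
  simp [wordCoeff, coeff_one]

/-- Induction principle: linear properties follow from monomials. -/
lemma poly_induct (P : ℝ[X] → Prop) (hadd : ∀ f g, P f → P g → P (f + g))
    (hsmul : ∀ (c : ℝ) f, P f → P (c • f)) (hpow : ∀ j, P (X ^ j)) (f : ℝ[X]) : P f := by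
  induction f using Polynomial.induction_on' with
  | add p q hp hq => exact hadd p q hp hq
  | monomial j c => rw [← smul_X_eq_monomial]; exact hsmul _ _ (hpow j)

lemma wordCoeff_transpose (hA : Aᵀ = A) (hM : Mᵀ = -M) (s : ℕ) (f : ℝ[X]) :
    (wordCoeff A M s f)ᵀ = (-1 : ℝ) ^ s • wordCoeff A M s f := by
  induction f using poly_induct with
  | hadd f g hf hg => simp [wordCoeff_add, hf, hg]
  | hsmul c f hf => rw [wordCoeff_smul, transpose_smul, hf, smul_comm]
  | hpow j =>
    induction j generalizing s with
    | zero => rw [pow_zero, wordCoeff_one]; split_ifs with h <;> simp [h]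
    | succ j ih =>
      rw [pow_succ']
      cases s with
      | zero =>
        rw [wordCoeff_X_mul_zero, transpose_mul, ih 0, hA, pow_zero, one_smul, one_smul,
          ← wordCoeff_X_mul_zero, wordCoeff_mul_X_zero]
      | succ s =>
        rw [wordCoeff_X_mul_succ, transpose_add, transpose_mul, transpose_mul, ih, ih, hA, hM,
          ← wordCoeff_X_mul_succ, wordCoeff_mul_X_succ]
        simp [pow_succ]

lemma wordCoeff_comm (s : ℕ) (f : ℝ[X]) :
    M * wordCoeff A M s f - wordCoeff A M s f * M
      = wordCoeff A M (s + 1) f * A - A * wordCoeff A M (s + 1) f := by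
  have h := (wordCoeff_X_mul_succ A M s f).symm.trans (wordCoeff_mul_X_succ A M s f)
  rw [sub_eq_sub_iff_add_eq_add, h, add_comm]

lemma pow_eq_sum_wordCoeff (j : ℕ) : ∃ N, (∀ s, N ≤ s → wordCoeff A M s (X ^ j) = 0) ∧
    ∀ τ : ℝ, (A + τ • M) ^ j = ∑ s ∈ Finset.range N, τ ^ s • wordCoeff A M s (X ^ j) := by
  refine ⟨(aeval (C A + C M * X : (Matrix (Fin n) (Fin n) ℝ)[X]) (X ^ j : ℝ[X])).natDegree + 1,
    fun s hs => coeff_eq_zero_of_natDegree_lt hs, fun τ => ?_⟩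
  have key : ∀ p : (Matrix (Fin n) (Fin n) ℝ)[X],
      (eval₂RingHom' (RingHom.id (Matrix (Fin n) (Fin n) ℝ)) (algebraMap ℝ _ τ)
        (fun a => (Algebra.commutes τ a).symm)) p
        = ∑ s ∈ Finset.range (p.natDegree + 1), τ ^ s • p.coeff s := by
    intro p
    show eval₂ _ _ p = _
    rw [eval₂_eq_sum_range]
    refine Finset.sum_congr rfl fun s _ => ?_
    rw [← map_pow, RingHom.id_apply, ← Algebra.commutes, ← Algebra.smul_def]
  refine Eq.trans ?_ (key (aeval (C A + C M * X) (X ^ j : ℝ[X])))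
  rw [map_pow, map_pow, aeval_X]
  congr 1
  show _ = eval₂ _ _ _
  rw [eval₂_add, eval₂_C, eval₂_mul_X, eval₂_C, RingHom.id_apply, RingHom.id_apply,
    ← Algebra.commutes, ← Algebra.smul_def]

end words

lemma coeff_mem_of_forall {V : Type*} [AddCommGroup V] [Module ℝ V] (L : Submodule ℝ V)
    (v : ℕ → V) (N0 : ℕ) (hN0 : ∀ s, N0 ≤ s → v s = 0)
    (h' : ∀ τ : ℝ, τ ≠ 0 → ∑ s ∈ Finset.range N0, τ ^ s • v s ∈ L) (s : ℕ) : v s ∈ L := by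
  by_contra hs
  obtain ⟨φ, hφ, hL⟩ := Submodule.exists_le_ker_of_notMem hs
  let q : Polynomial ℝ := ∑ s ∈ Finset.range N0, Polynomial.monomial s (φ (v s))
  have hq : q = 0 := by
    apply Polynomial.eq_zero_of_infinite_isRoot
    apply Set.Infinite.mono (s := {0}ᶜ)
    · intro τ hτ
      have := hL (h' τ hτ)
      rw [LinearMap.mem_ker, map_sum] at this
      simp only [Set.mem_ofPred_eq, Polynomial.IsRoot.def, q, Polynomial.eval_finsetSum, Polynomial.eval_monomial]
      rw [← this]
      refine Finset.sum_congr rfl fun s _ => ?_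
      simp [mul_comm]
    · exact (Set.finite_singleton 0).infinite_compl
  have hc : q.coeff s = φ (v s) := by
    simp only [q, Polynomial.finsetSum_coeff, Polynomial.coeff_monomial]
    rw [Finset.sum_ite_eq']
    split_ifs with h1
    · rfl
    · rw [hN0 s (by simpa using h1), map_zero]
  rw [hq] at hc
  exact hφ (by simpa using hc.symm)

/-- `skewPart` as a linear map. -/
noncomputable def skewLin (n : ℕ) : Matrix (Fin n) (Fin n) ℝ →ₗ[ℝ] Matrix (Fin n) (Fin n) ℝ where
  toFun := skewPart
  map_add' P Q := by simp only [skewPart, transpose_add]; module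
  map_smul' c P := by simp only [skewPart, transpose_smul, RingHom.id_apply]; module

lemma skewPart_of_skew {n : ℕ} {P : Matrix (Fin n) (Fin n) ℝ} (h : Pᵀ = -P) : skewPart P = P := by
  rw [skewPart, h]; module

lemma skewPart_transpose {n : ℕ} (P : Matrix (Fin n) (Fin n) ℝ) :
    (skewPart P)ᵀ = -skewPart P := by
  simp only [skewPart, transpose_smul, transpose_sub, transpose_transpose]; module

lemma skewPart_wordCoeff_mem {n : ℕ} (A M : Matrix (Fin n) (Fin n) ℝ) (s : ℕ)
    (f : Polynomial ℝ) :
    skewPart (wordCoeff A M s f) ∈ Submodule.span ℝ (manakovGradients A M) := by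
  induction f using poly_induct with
  | hadd f g hf hg =>
    rw [wordCoeff_add]
    have := (skewLin n).map_add (wordCoeff A M s f) (wordCoeff A M s g)
    change skewPart _ = skewPart _ + skewPart _ at this
    rw [this]; exact add_mem hf hg
  | hsmul c f hf =>
    rw [wordCoeff_smul]
    have := (skewLin n).map_smul c (wordCoeff A M s f)
    change skewPart _ = c • skewPart _ at this
    rw [this]; exact Submodule.smul_mem _ _ hf
  | hpow j =>
    obtain ⟨N, hN0, hN⟩ := pow_eq_sum_wordCoeff A M j
    refine coeff_mem_of_forall _ (fun s => skewLin n (wordCoeff A M s (Polynomial.X ^ j))) N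
      (fun s hs => by simp [hN0 s hs]) ?_ s
    intro τ hτ
    have h1 : ∑ s ∈ Finset.range N, τ ^ s • skewLin n (wordCoeff A M s (Polynomial.X ^ j))
        = τ ^ j • skewLin n ((M + τ⁻¹ • A) ^ j) := by
      rw [← map_smul, ← smul_pow, smul_add, smul_smul, mul_inv_cancel₀ hτ, one_smul, add_comm,
        hN τ, map_sum]
      simp
    rw [h1]
    exact Submodule.smul_mem _ _ (Submodule.subset_span ⟨τ⁻¹, j, rfl⟩)

/-- The commutator with `M` as a linear map. -/
noncomputable def adLin {n : ℕ} (M : Matrix (Fin n) (Fin n) ℝ) :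
    Matrix (Fin n) (Fin n) ℝ →ₗ[ℝ] Matrix (Fin n) (Fin n) ℝ :=
  LinearMap.mulLeft ℝ M - LinearMap.mulRight ℝ M

lemma adLin_apply {n : ℕ} (M X : Matrix (Fin n) (Fin n) ℝ) : adLin M X = M * X - X * M := rfl

/-- `L_M + so_A + [M, L_M]`. -/
noncomputable def bigSpan {n : ℕ} (A M : Matrix (Fin n) (Fin n) ℝ) :
    Submodule ℝ (Matrix (Fin n) (Fin n) ℝ) :=
  (Submodule.span ℝ (manakovGradients A M) ⊔ Submodule.span ℝ (soA A)) ⊔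
    (Submodule.span ℝ (manakovGradients A M)).map (adLin M)

/-! ### Isotropy -/

lemma trace_bracket {n : ℕ} (M X Y : Matrix (Fin n) (Fin n) ℝ) :
    (M * (X * Y - Y * X)).trace = ((M * X - X * M) * Y).trace := by
  rw [mul_sub, sub_mul, trace_sub, trace_sub, ← mul_assoc, ← mul_assoc, trace_mul_cycle M Y X]

lemma bracket_skew {n : ℕ} {M X : Matrix (Fin n) (Fin n) ℝ} (hM : Mᵀ = -M) (hX : Xᵀ = -X) :
    (M * X - X * M)ᵀ = -(M * X - X * M) := by
  rw [transpose_sub, transpose_mul, transpose_mul, hM, hX]; noncomm_ring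

lemma trace_skew_mul_skewPart {n : ℕ} {N P : Matrix (Fin n) (Fin n) ℝ} (hN : Nᵀ = -N) :
    (N * skewPart P).trace = (N * P).trace := by
  have h : (N * Pᵀ).trace = -(N * P).trace := by
    rw [← trace_transpose, transpose_mul, transpose_transpose, hN, mul_neg, trace_neg,
      trace_mul_comm]
  rw [skewPart, mul_smul_comm, mul_sub, trace_smul, trace_sub, h, smul_eq_mul]; ring

lemma pencil_transpose {n : ℕ} {A M : Matrix (Fin n) (Fin n) ℝ} (hA : Aᵀ = A) (hM : Mᵀ = -M)
    (lam : ℝ) (j : ℕ) :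
    ((M + lam • A) ^ j)ᵀ = (-1 : ℝ) ^ j • (M + (-lam) • A) ^ j := by
  rw [transpose_pow, ← smul_pow]; congr 1
  rw [transpose_add, transpose_smul, hA, hM]; module

lemma trace_pencil {n : ℕ} (A M : Matrix (Fin n) (Fin n) ℝ) (x y : ℝ) (i j : ℕ) :
    ((M * (M + x • A) ^ i - (M + x • A) ^ i * M) * (M + y • A) ^ j).trace = 0 := by
  by_cases hxy : x = y
  · subst hxy
    rw [← trace_bracket, ← pow_add, ← pow_add, add_comm i j, sub_self, mul_zero, trace_zero]
  · set B := M + x • A with hB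
    set D := M + y • A with hD
    have h1 : ((B * B ^ i - B ^ i * B) * D ^ j).trace = 0 := by
      rw [← pow_succ, ← pow_succ', sub_self, zero_mul, trace_zero]
    have h2 : ((D * B ^ i - B ^ i * D) * D ^ j).trace = 0 := by
      rw [sub_mul, trace_sub, mul_assoc, mul_assoc, trace_mul_comm, mul_assoc, ← pow_succ,
        ← pow_succ', sub_self]
    have h3 : (y - x) • M = y • B - x • D := by rw [hB, hD]; module
    have h4 : (y - x) • ((M * B ^ i - B ^ i * M) * D ^ j)
        = y • ((B * B ^ i - B ^ i * B) * D ^ j) - x • ((D * B ^ i - B ^ i * D) * D ^ j) := by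
      rw [← smul_mul_assoc, smul_sub, ← smul_mul_assoc, ← mul_smul_comm, h3]
      simp only [sub_mul, mul_sub, smul_mul_assoc, mul_smul_comm, smul_sub]
      abel
    have h5 := congrArg trace h4
    rw [trace_smul, trace_sub, trace_smul, trace_smul, h1, h2] at h5
    simpa [sub_eq_zero, Ne.symm hxy, eq_comm] using h5

lemma isotropy {n : ℕ} {A M : Matrix (Fin n) (Fin n) ℝ} (hA : Aᵀ = A) (hM : Mᵀ = -M)
    {X : Matrix (Fin n) (Fin n) ℝ}
    (hX : X ∈ Submodule.span ℝ (manakovGradients A M) ⊔ Submodule.span ℝ (soA A)) :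
    Xᵀ = -X ∧ ∀ Y ∈ Submodule.span ℝ (manakovGradients A M),
      (M * (X * Y - Y * X)).trace = 0 := by
  rw [← Submodule.span_union] at hX
  induction hX using Submodule.span_induction with
  | zero => simp
  | add X X' _ _ h h' =>
    refine ⟨by rw [transpose_add, h.1, h'.1]; abel, fun Y hY => ?_⟩
    have := congrArg₂ (· + ·) (h.2 Y hY) (h'.2 Y hY)
    simp only [← trace_add, add_zero] at this
    rw [← this]; congr 1; noncomm_ring
  | smul c X _ h =>
    refine ⟨by rw [transpose_smul, h.1, smul_neg], fun Y hY => ?_⟩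
    have := h.2 Y hY
    rw [smul_mul_assoc, mul_smul_comm, ← smul_sub, mul_smul_comm, trace_smul, this, smul_zero]
  | mem X hX =>
    have hsk : Xᵀ = -X := by
      rcases hX with ⟨x, i, rfl⟩ | h
      · exact skewPart_transpose _
      · exact h.1
    refine ⟨hsk, fun Y hY => ?_⟩
    induction hY using Submodule.span_induction with
    | zero => simp
    | add Y Y' _ _ h h' =>
      have := congrArg₂ (· + ·) h h'
      simp only [← trace_add, add_zero] at this
      rw [← this]; congr 1; noncomm_ring
    | smul c Y _ h =>
      rw [smul_mul_assoc, mul_smul_comm, ← smul_sub, mul_smul_comm, trace_smul, h, smul_zero]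
    | mem Y hY =>
      obtain ⟨y, j, rfl⟩ := hY
      rw [trace_bracket, trace_skew_mul_skewPart (bracket_skew hM hsk)]
      rcases hX with ⟨x, i, rfl⟩ | h
      · have h1 := trace_pencil A M x y i j
        have h2 := trace_pencil A M (-x) y i j
        rw [skewPart, pencil_transpose hA hM]
        set B := (M + x • A) ^ i
        set B' := (M + (-x) • A) ^ i
        set D := (M + y • A) ^ j
        have h4 : (M * ((1 / 2 : ℝ) • (B - (-1 : ℝ) ^ i • B'))
            - ((1 / 2 : ℝ) • (B - (-1 : ℝ) ^ i • B')) * M) * D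
            = (1 / 2 : ℝ) • ((M * B - B * M) * D)
              - (1 / 2 * (-1 : ℝ) ^ i) • ((M * B' - B' * M) * D) := by
          simp only [sub_mul, mul_sub, smul_mul_assoc, mul_smul_comm, smul_sub, smul_smul]
          abel
        rw [h4, trace_sub, trace_smul, trace_smul, h1, h2]; simp
      · have h1 : M * X - X * M = (M + y • A) * X - X * (M + y • A) := by
          rw [add_mul, mul_add, smul_mul_assoc, mul_smul_comm, h.2]; abel
        rw [h1, sub_mul, trace_sub, mul_assoc, mul_assoc, trace_mul_comm, mul_assoc, ← pow_succ,
          ← pow_succ', sub_self]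

lemma complement_of_bigSpan {n : ℕ} {A M : Matrix (Fin n) (Fin n) ℝ} (hA : Aᵀ = A)
    (hM : Mᵀ = -M) (hspan : ∀ X : Matrix (Fin n) (Fin n) ℝ, Xᵀ = -X → X ∈ bigSpan A M)
    (X : Matrix (Fin n) (Fin n) ℝ) :
    (Xᵀ = -X ∧ ∀ Y ∈ Submodule.span ℝ (manakovGradients A M),
      (M * (X * Y - Y * X)).trace = 0) ↔
    X ∈ Submodule.span ℝ (manakovGradients A M) ⊔ Submodule.span ℝ (soA A) := by
  refine ⟨fun ⟨hX, h⟩ => ?_, isotropy hA hM⟩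
  obtain ⟨Z, hZ, W, hW, rfl⟩ := Submodule.mem_sup.1 (hspan X hX)
  obtain ⟨V, hV, rfl⟩ := Submodule.mem_map.1 hW
  have hZ' := isotropy hA hM hZ
  have hV' := isotropy hA hM (Submodule.mem_sup_left hV)
  have h1 : ((adLin M V) * (adLin M V)).trace = 0 := by
    have h2 := h V hV
    have h3 := hZ'.2 V hV
    have h4 : (M * (adLin M V * V - V * adLin M V)).trace = 0 := by
      rw [← sub_eq_zero.2 (h2.trans h3.symm), ← trace_sub]; congr 1; noncomm_ring
    rw [adLin_apply] at h4 ⊢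
    set N := M * V - V * M
    have h5 : (M * (N * V - V * N)).trace = -(N * N).trace := by
      rw [← neg_sub (V * N), mul_neg, trace_neg, trace_bracket]
    linarith
  have hsk := bracket_skew hM hV'.1
  rw [← adLin_apply] at hsk
  have h2 : ((adLin M V)ᴴ * (adLin M V)).trace = 0 := by
    rw [conjTranspose_eq_transpose_of_trivial, hsk, neg_mul, trace_neg, h1, neg_zero]
  rw [trace_conjTranspose_mul_self_eq_zero_iff] at h2
  rw [h2, add_zero]; exact hZ

/-! ### The tridiagonal example -/

/-- The tridiagonal skew-symmetric matrix. -/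
def triM (n : ℕ) : Matrix (Fin n) (Fin n) ℝ := fun i j =>
  if (j : ℕ) = i + 1 then 1 else if (i : ℕ) = j + 1 then -1 else 0

lemma triM_transpose (n : ℕ) : (triM n)ᵀ = -triM n := by
  ext i j
  rw [transpose_apply, Matrix.neg_apply]
  unfold triM
  split_ifs <;> first | omega | simp

section tri
open Polynomial
variable {n : ℕ} (a : Fin n → ℝ)

lemma word_band (s : ℕ) (f : ℝ[X]) (i j : Fin n) (h : (i : ℕ) + s < j) :
    wordCoeff (diagonal a) (triM n) s f i j = 0 := by
  induction f using poly_induct with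
  | hadd f g hf hg => simp [wordCoeff_add, hf, hg]
  | hsmul c f hf => simp [wordCoeff_smul, hf]
  | hpow m =>
    induction m generalizing s i with
    | zero =>
      rw [pow_zero, wordCoeff_one]
      split_ifs
      · rw [one_apply_ne]; rintro rfl; omega
      · simp
    | succ m ih =>
      rw [pow_succ']
      cases s with
      | zero => rw [wordCoeff_X_mul_zero, diagonal_mul, ih 0 i h, mul_zero]
      | succ s =>
        rw [wordCoeff_X_mul_succ, Matrix.add_apply, diagonal_mul, ih _ _ h, mul_zero, add_zero, mul_apply]
        refine Finset.sum_eq_zero fun k _ => ?_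
        by_cases hk : (k : ℕ) + s < j
        · rw [ih _ _ hk, mul_zero]
        · rw [triM, if_neg (by omega), if_neg (by omega), zero_mul]

lemma word_left (s : ℕ) (g : ℝ[X]) (i i' j : Fin n) (hi : (i' : ℕ) = i + 1)
    (hj : (j : ℕ) = i + (s + 1)) :
    wordCoeff (diagonal a) (triM n) (s + 1) ((X - C (a i)) * g) i j
      = wordCoeff (diagonal a) (triM n) s g i' j := by
  rw [sub_mul, C_mul', wordCoeff_sub, wordCoeff_smul, wordCoeff_X_mul_succ, Matrix.sub_apply, Matrix.add_apply,
    diagonal_mul, Matrix.smul_apply, smul_eq_mul, add_sub_cancel_right, mul_apply,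
    Finset.sum_eq_single i']
  · rw [triM, if_pos hi, one_mul]
  · intro k _ hk
    by_cases hk' : (k : ℕ) + s < j
    · rw [word_band _ _ _ _ _ hk', mul_zero]
    · have : (k : ℕ) ≠ i' := fun h => hk (Fin.ext h)
      rw [triM, if_neg (by omega), if_neg (by omega), zero_mul]
  · simp

lemma word_right (s : ℕ) (g : ℝ[X]) (i j j' : Fin n) (hi : (j : ℕ) = j' + 1)
    (hj : (j : ℕ) = i + (s + 1)) :
    wordCoeff (diagonal a) (triM n) (s + 1) ((X - C (a j)) * g) i j
      = wordCoeff (diagonal a) (triM n) s g i j' := by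
  rw [sub_mul, C_mul', wordCoeff_sub, wordCoeff_smul, wordCoeff_mul_X_succ, Matrix.sub_apply, Matrix.add_apply,
    mul_diagonal, Matrix.smul_apply, smul_eq_mul, mul_comm (a j), add_sub_cancel_right, mul_apply,
    Finset.sum_eq_single j']
  · rw [triM, if_pos hi, mul_one]
  · intro k _ hk
    by_cases hk' : (i : ℕ) + s < k
    · rw [word_band _ _ _ _ _ hk', zero_mul]
    · have : (k : ℕ) ≠ j' := fun h => hk (Fin.ext h)
      rw [triM, if_neg (by omega), if_neg (by omega), mul_zero]
  · simp

lemma word_zero (g : ℝ[X]) (i : Fin n) :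
    wordCoeff (diagonal a) (triM n) 0 g i i = g.eval (a i) := by
  induction g using poly_induct with
  | hadd f g hf hg => simp [wordCoeff_add, hf, hg]
  | hsmul c f hf => simp [wordCoeff_smul, hf]
  | hpow m =>
    induction m with
    | zero => simp [wordCoeff_one]
    | succ m ih =>
      rw [pow_succ', wordCoeff_X_mul_zero, diagonal_mul, ih]; simp

/-- Product over indices with value in `[lo, hi)`. -/
noncomputable def winProd (lo hi : ℕ) : ℝ[X] :=
  ∏ l ∈ Finset.univ.filter (fun l : Fin n => lo ≤ (l : ℕ) ∧ (l : ℕ) < hi), (X - C (a l))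

lemma winProd_left (i : Fin n) (hi : ℕ) (h : (i : ℕ) < hi) :
    winProd a i hi = (X - C (a i)) * winProd a (i + 1) hi := by
  rw [winProd, winProd, ← Finset.prod_insert (f := fun l => X - C (a l))]
  · congr 1; ext l; simp [Fin.ext_iff]; omega
  · simp

lemma winProd_right (lo : ℕ) (j : Fin n) (h : lo ≤ (j : ℕ)) :
    winProd a lo (j + 1) = (X - C (a j)) * winProd a lo j := by
  rw [winProd, winProd, ← Finset.prod_insert (f := fun l => X - C (a l))]
  · congr 1; ext l; simp [Fin.ext_iff]; omega
  · simp

lemma winProd_split (lo mid hi : ℕ) (h : lo ≤ mid) (h' : mid ≤ hi) :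
    winProd a lo hi = winProd a lo mid * winProd a mid hi := by
  rw [winProd, winProd, winProd, ← Finset.prod_union]
  · congr 1; ext l; simp; omega
  · rw [Finset.disjoint_left]; simp; omega

lemma winProd_self (lo : ℕ) : winProd a lo lo = 1 := by
  rw [winProd, Finset.filter_false_of_mem, Finset.prod_empty]
  intros; omega

lemma word_kill (s : ℕ) (g : ℝ[X]) (i j : Fin n) (hj : (j : ℕ) = i + s) :
    wordCoeff (diagonal a) (triM n) s (winProd a i (j + 1) * g) i j = 0 := by
  induction s generalizing i with
  | zero =>
    have : j = i := Fin.ext (by omega)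
    subst this
    rw [word_zero, winProd_left _ _ _ (by omega)]; simp
  | succ s ih =>
    have hlt : (i : ℕ) + 1 < n := by omega
    rw [winProd_left _ _ _ (by omega), mul_assoc, word_left a s _ i ⟨i + 1, hlt⟩ j rfl hj]
    exact ih ⟨i + 1, hlt⟩ (by simp; omega)

lemma word_val (s : ℕ) (g : ℝ[X]) (i j : Fin n) (hj : (j : ℕ) = i + s) :
    wordCoeff (diagonal a) (triM n) s (winProd a (i + 1) (j + 1) * g) i j = g.eval (a i) := by
  induction s generalizing j with
  | zero =>
    have : j = i := Fin.ext (by omega)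
    subst this
    rw [winProd_self, one_mul, word_zero]
  | succ s ih =>
    have hlt : (i : ℕ) + s < n := by omega
    rw [winProd_right _ _ _ (by omega), mul_assoc,
      word_right a s _ i j ⟨i + s, hlt⟩ (by simp; omega) hj]
    have := ih ⟨i + s, hlt⟩ rfl
    rwa [show ((⟨i + s, hlt⟩ : Fin n) : ℕ) + 1 = j by simp; omega] at this

end tri

/-- Elementary skew-symmetric matrices. -/
noncomputable def skewE {n : ℕ} (i j : Fin n) : Matrix (Fin n) (Fin n) ℝ :=
  single i j 1 - single j i 1

lemma skew_eq_sum {n : ℕ} (Y : Matrix (Fin n) (Fin n) ℝ) (hY : Yᵀ = -Y) :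
    Y = ∑ i, ∑ j, (if i < j then Y i j else 0) • skewE i j := by
  have hs : ∀ p q, Y q p = -Y p q := fun p q => congrFun (congrFun hY p) q
  ext p q
  have h1 : ∀ i j : Fin n, ((if i < j then Y i j else 0) • skewE i j) p q
      = (if i = p then if j = q then (if p < q then Y p q else 0) else 0 else 0)
        - (if j = p then if i = q then (if q < p then Y q p else 0) else 0 else 0) := by
    intro i j
    clear hs hY
    simp only [skewE, Matrix.smul_apply, Matrix.sub_apply, single_apply, smul_eq_mul]
    grind
  simp only [Matrix.sum_apply, h1, Finset.sum_sub_distrib]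
  have h2 : ∀ c : ℝ, ∑ i : Fin n, ∑ j : Fin n, (if i = p then if j = q then c else 0 else 0) = c := by
    intro c
    rw [Finset.sum_eq_single p]
    · simp
    · intro b _ hb; simp [hb]
    · simp
  have h3 : ∀ c : ℝ, ∑ i : Fin n, ∑ j : Fin n, (if j = p then if i = q then c else 0 else 0) = c := by
    intro c
    rw [Finset.sum_eq_single q]
    · simp
    · intro b _ hb; simp [hb]
    · simp
  rw [h2, h3]
  rcases lt_trichotomy p q with h | h | h
  · simp [h, h.not_gt]
  · subst h; have := hs p p; simp; linarith
  · simp [h, h.not_gt, hs p q]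

lemma peel {n : ℕ} (V : Submodule ℝ (Matrix (Fin n) (Fin n) ℝ)) (i j : Fin n) (hij : i < j)
    (Y : Matrix (Fin n) (Fin n) ℝ) (hY : Yᵀ = -Y) (hYV : Y ∈ V) (hne : Y i j ≠ 0)
    (h : ∀ p q : Fin n, p < q → (p ≠ i ∨ q ≠ j) → Y p q = 0 ∨ skewE p q ∈ V) :
    skewE i j ∈ V := by
  have hsum := skew_eq_sum Y hY
  have hterm : ∀ p q : Fin n, (p ≠ i ∨ q ≠ j) → (if p < q then Y p q else 0) • skewE p q ∈ V := by
    intro p q hpq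
    split_ifs with hlt
    · rcases h p q hlt hpq with h0 | h0
      · rw [h0, zero_smul]; exact V.zero_mem
      · exact V.smul_mem _ h0
    · rw [zero_smul]; exact V.zero_mem
  rw [← Finset.add_sum_erase _ _ (Finset.mem_univ i),
    ← Finset.add_sum_erase _ _ (Finset.mem_univ j), if_pos hij] at hsum
  have h1 : Y i j • skewE i j ∈ V := by
    rw [hsum, add_assoc] at hYV
    refine (V.add_mem_iff_left (add_mem ?_ ?_)).1 hYV
    · exact sum_mem fun q hq => hterm _ _ (Or.inr (Finset.ne_of_mem_erase hq))
    · exact sum_mem fun p hp => sum_mem fun q _ => hterm _ _ (Or.inl (Finset.ne_of_mem_erase hp))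
  exact (V.smul_mem_iff hne).1 h1

lemma tri_skewE_mem {n r : ℕ} (blk : Fin n → Fin r) (hmono : Monotone blk)
    (α : Fin r → ℝ) (hα : Function.Injective α) (s : ℕ) :
    ∀ (m : ℕ) (i j : Fin n), (i : ℕ) = m → (j : ℕ) = i + (s + 1) →
      skewE i j ∈ bigSpan (diagonal fun i => α (blk i)) (triM n) := by
  induction s using Nat.strong_induction_on with
  | _ s ihs =>
  intro m
  induction m using Nat.strong_induction_on with
  | _ m ihm =>
  intro i j hi hj
  set a : Fin n → ℝ := fun i => α (blk i) with ha
  have hAt : (diagonal a)ᵀ = diagonal a := diagonal_transpose a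
  by_cases hb : blk i = blk j
  · refine Submodule.mem_sup_left (Submodule.mem_sup_right (Submodule.subset_span ⟨?_, ?_⟩))
    · simp [skewE]
    · have : a i = a j := by simp [ha, hb]
      ext p q
      simp only [skewE, mul_diagonal, diagonal_mul, Matrix.sub_apply, single_apply]
      clear ihs ihm
      clear_value a
      grind
  · have hij : i < j := by rw [Fin.lt_def]; omega
    have hne : ∀ l : Fin n, j ≤ l → a i ≠ a l := by
      intro l hl h
      have h1 := hα h
      have h2 := hmono hij.le
      have h3 := hmono hl
      exact hb (le_antisymm h2 (h1 ▸ h3))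
    set f := winProd a (i + 1) n with hf
    set W := wordCoeff (diagonal a) (triM n) (s + 1) f with hW
    have hWij : W i j ≠ 0 := by
      rw [hW, hf, winProd_split a (i + 1) (j + 1) n (by omega) (by omega),
        word_val a (s + 1) _ i j hj, winProd, Polynomial.eval_prod, Finset.prod_ne_zero_iff]
      intro l hl
      simp only [Finset.mem_filter] at hl
      simp only [Polynomial.eval_sub, Polynomial.eval_X, Polynomial.eval_C]
      exact sub_ne_zero.2 (hne l (by rw [Fin.le_def]; omega))
    have hWkill : ∀ p q : Fin n, i < p → (q : ℕ) = p + (s + 1) → W p q = 0 := by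
      intro p q hp hq
      rw [Fin.lt_def] at hp
      rw [hW, hf, winProd_split a (i + 1) p n (by omega) (by omega),
        winProd_split a p (q + 1) n (by omega) (by omega), mul_left_comm,
        word_kill a (s + 1) _ p q hq]
    have hWband : ∀ p q : Fin n, (p : ℕ) + (s + 1) < q → W p q = 0 :=
      fun p q h => word_band a _ _ p q h
    have hrest : ∀ p q : Fin n, p < q → (p ≠ i ∨ q ≠ j) →
        W p q = 0 ∨ skewE p q ∈ bigSpan (diagonal a) (triM n) := by
      intro p q hpq hor
      rw [Fin.lt_def] at hpq
      rcases lt_trichotomy ((p : ℕ) + (s + 1)) q with h | h | h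
      · exact Or.inl (hWband p q h)
      · rcases lt_trichotomy (p : ℕ) i with h' | h' | h'
        · exact Or.inr (ihm p (by omega) p q rfl h.symm)
        · exfalso
          have e1 : p = i := Fin.ext h'
          have e2 : q = j := Fin.ext (by omega)
          tauto
        · exact Or.inl (hWkill p q h' h.symm)
      · exact Or.inr (ihs (q - p - 1) (by omega) p p q rfl (by omega))
    rcases Nat.even_or_odd (s + 1) with hpar | hpar
    · -- even band
      have hs : Odd s := by
        rcases Nat.even_or_odd s with h | h
        · exact absurd hpar (by simpa [Nat.even_add_one] using h)
        · exact h
      set P := wordCoeff (diagonal a) (triM n) s f with hP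
      have hPt : Pᵀ = -P := by
        rw [hP, wordCoeff_transpose _ _ hAt (triM_transpose n), hs.neg_one_pow]; simp
      have hcomm := wordCoeff_comm (diagonal a) (triM n) s f
      rw [← hP, ← hW] at hcomm
      have hent : ∀ p q, (adLin (triM n) P) p q = W p q * (a q - a p) := by
        intro p q
        rw [adLin_apply, hcomm, Matrix.sub_apply, mul_diagonal, diagonal_mul]; ring
      have hsk : skewPart P = P := skewPart_of_skew hPt
      refine peel _ i j hij (adLin (triM n) P) ?_ ?_ ?_ ?_
      · rw [adLin_apply]; exact bracket_skew (triM_transpose n) hPt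
      · refine Submodule.mem_sup_right (Submodule.mem_map_of_mem ?_)
        rw [← hsk, hP]; exact skewPart_wordCoeff_mem _ _ _ _
      · rw [hent]; exact mul_ne_zero hWij (sub_ne_zero.2 (hne j le_rfl).symm)
      · intro p q hpq hor
        rcases hrest p q hpq hor with h | h
        · left; rw [hent, h, zero_mul]
        · exact Or.inr h
    · have hWt : Wᵀ = -W := by
        rw [hW, wordCoeff_transpose _ _ hAt (triM_transpose n), hpar.neg_one_pow]; simp
      refine peel _ i j hij W hWt ?_ hWij hrest
      refine Submodule.mem_sup_left (Submodule.mem_sup_left ?_)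
      rw [← skewPart_of_skew hWt, hW]; exact skewPart_wordCoeff_mem _ _ _ _

lemma tri_bigSpan {n r : ℕ} (blk : Fin n → Fin r) (hmono : Monotone blk)
    (α : Fin r → ℝ) (hα : Function.Injective α) (Y : Matrix (Fin n) (Fin n) ℝ) (hY : Yᵀ = -Y) :
    Y ∈ bigSpan (diagonal fun i => α (blk i)) (triM n) := by
  rw [skew_eq_sum Y hY]
  refine sum_mem fun i _ => sum_mem fun j _ => ?_
  split_ifs with h
  · rw [Fin.lt_def] at h
    exact Submodule.smul_mem _ _ (tri_skewE_mem blk hmono α hα (j - i - 1) i i j rfl (by omega))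
  · rw [zero_smul]; exact zero_mem _

/-! ### Genericity -/

/-- Polynomial functions of the entries. -/
def polyFun (n : ℕ) : Subalgebra ℝ (Matrix (Fin n) (Fin n) ℝ → ℝ) :=
  Algebra.adjoin ℝ (Set.range fun (ij : Fin n × Fin n) (M : Matrix (Fin n) (Fin n) ℝ) =>
    M ij.1 ij.2)

lemma polyFun_continuous {n : ℕ} {g : Matrix (Fin n) (Fin n) ℝ → ℝ} (hg : g ∈ polyFun n) :
    Continuous g := by
  induction hg using Algebra.adjoin_induction with
  | mem x hx => obtain ⟨ij, rfl⟩ := hx; exact continuous_id.matrix_elem _ _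
  | algebraMap c => exact continuous_const
  | add x y _ _ hx hy => exact hx.add hy
  | mul x y _ _ hx hy => exact hx.mul hy

lemma polyFun_line {n : ℕ} {g : Matrix (Fin n) (Fin n) ℝ → ℝ} (hg : g ∈ polyFun n)
    (M N : Matrix (Fin n) (Fin n) ℝ) :
    ∃ q : Polynomial ℝ, ∀ t : ℝ, g (M + t • N) = q.eval t := by
  induction hg using Algebra.adjoin_induction with
  | mem x hx =>
    obtain ⟨ij, rfl⟩ := hx
    refine ⟨Polynomial.C (M ij.1 ij.2) + Polynomial.X * Polynomial.C (N ij.1 ij.2), fun t => ?_⟩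
    simp
    ring
  | algebraMap c => exact ⟨Polynomial.C c, fun t => by simp⟩
  | add x y _ _ hx hy =>
    obtain ⟨q, hq⟩ := hx
    obtain ⟨q', hq'⟩ := hy
    exact ⟨q + q', fun t => by simp [hq, hq']⟩
  | mul x y _ _ hx hy =>
    obtain ⟨q, hq⟩ := hx
    obtain ⟨q', hq'⟩ := hy
    exact ⟨q * q', fun t => by simp [hq, hq']⟩

lemma polyFun_open_dense {n : ℕ} {g : Matrix (Fin n) (Fin n) ℝ → ℝ} (hg : g ∈ polyFun n)
    (M₀ : Matrix (Fin n) (Fin n) ℝ) (hM₀ : M₀ᵀ = -M₀) (h0 : g M₀ ≠ 0) :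
    IsOpen {M : {X : Matrix (Fin n) (Fin n) ℝ // Xᵀ = -X} | g M.1 ≠ 0} ∧
    Dense {M : {X : Matrix (Fin n) (Fin n) ℝ // Xᵀ = -X} | g M.1 ≠ 0} := by
  constructor
  · exact isOpen_ne_fun ((polyFun_continuous hg).comp continuous_subtype_val) continuous_const
  · intro M
    obtain ⟨q, hq⟩ := polyFun_line hg M.1 (M₀ - M.1)
    have hq0 : q ≠ 0 := by
      rintro rfl
      have := hq 1
      simp at this
      exact h0 this
    let γ : ℝ → {X : Matrix (Fin n) (Fin n) ℝ // Xᵀ = -X} := fun t =>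
      ⟨M.1 + t • (M₀ - M.1), by
        rw [transpose_add, transpose_smul, transpose_sub, hM₀, M.2]; module⟩
    have hγ : Continuous γ := by
      refine Continuous.subtype_mk ?_ _
      fun_prop
    have hdense : Dense ({t : ℝ | q.IsRoot t}ᶜ) :=
      ((Polynomial.finite_setOfPred_isRoot hq0).countable).dense_compl ℝ
    have h1 : γ 0 = M := by apply Subtype.ext; simp [γ]
    rw [← h1]
    refine map_mem_closure hγ (hdense 0) ?_
    intro t ht
    simp only [Set.mem_ofPred_eq, γ, hq]
    exact ht

/-- Matrix-valued functions with polynomial entries. -/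
def PolyMat {n : ℕ} (F : Matrix (Fin n) (Fin n) ℝ → Matrix (Fin n) (Fin n) ℝ) : Prop :=
  ∀ i j, (fun M => F M i j) ∈ polyFun n

section polymat
variable {n : ℕ} {F G : Matrix (Fin n) (Fin n) ℝ → Matrix (Fin n) (Fin n) ℝ}

lemma PolyMat.id' : PolyMat (fun M : Matrix (Fin n) (Fin n) ℝ => M) := fun i j =>
  Algebra.subset_adjoin ⟨(i, j), rfl⟩

lemma PolyMat.const (B : Matrix (Fin n) (Fin n) ℝ) :
    PolyMat (fun _ : Matrix (Fin n) (Fin n) ℝ => B) := fun i j =>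
  (polyFun n).algebraMap_mem (B i j)

lemma PolyMat.add (hF : PolyMat F) (hG : PolyMat G) : PolyMat (fun M => F M + G M) :=
  fun i j => (polyFun n).add_mem (hF i j) (hG i j)

lemma PolyMat.sub (hF : PolyMat F) (hG : PolyMat G) : PolyMat (fun M => F M - G M) :=
  fun i j => (polyFun n).sub_mem (hF i j) (hG i j)

lemma PolyMat.smul (c : ℝ) (hF : PolyMat F) : PolyMat (fun M => c • F M) :=
  fun i j => (polyFun n).smul_mem (hF i j) c

lemma PolyMat.transpose (hF : PolyMat F) : PolyMat (fun M => (F M)ᵀ) :=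
  fun i j => hF j i

lemma PolyMat.mul (hF : PolyMat F) (hG : PolyMat G) : PolyMat (fun M => F M * G M) := by
  intro i j
  have : (fun M => (F M * G M) i j) = ∑ k, (fun M => F M i k) * (fun M => G M k j) := by
    ext M; simp [Matrix.mul_apply]
  rw [this]
  exact sum_mem fun k _ => mul_mem (hF i k) (hG k j)

lemma PolyMat.pow (hF : PolyMat F) (k : ℕ) : PolyMat (fun M => F M ^ k) := by
  induction k with
  | zero => simpa using PolyMat.const 1
  | succ k ih => simpa [pow_succ] using ih.mul hF

lemma PolyMat.skewPart (hF : PolyMat F) : PolyMat (fun M => skewPart (F M)) :=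
  (hF.sub hF.transpose).smul _

lemma PolyMat.linear (hF : PolyMat F) (φ : Matrix (Fin n) (Fin n) ℝ →ₗ[ℝ] ℝ) :
    (fun M => φ (F M)) ∈ polyFun n := by
  have : (fun M => φ (F M)) = ∑ i, ∑ j, φ (single i j 1) • (fun M => F M i j) := by
    ext M
    conv_lhs => rw [matrix_eq_sum_single (F M)]
    simp only [map_sum, Finset.sum_apply, Pi.smul_apply, smul_eq_mul]
    refine Finset.sum_congr rfl fun i _ => Finset.sum_congr rfl fun j _ => ?_
    rw [mul_comm, ← smul_eq_mul, ← map_smul, smul_single, smul_eq_mul, mul_one]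
  rw [this]
  exact sum_mem fun i _ => sum_mem fun j _ => (polyFun n).smul_mem (hF i j) _

end polymat

/-- The submodule of skew-symmetric matrices. -/
def skewSub (n : ℕ) : Submodule ℝ (Matrix (Fin n) (Fin n) ℝ) where
  carrier := {X | Xᵀ = -X}
  add_mem' := by
    intro X Y hX hY
    simp only [Set.mem_ofPred_eq] at *
    rw [transpose_add, hX, hY]; abel
  zero_mem' := by simp
  smul_mem' := by
    intro c X hX
    simp only [Set.mem_ofPred_eq] at *
    rw [transpose_smul, hX, smul_neg]

lemma generic_span {n : ℕ} {ι : Type} (e : ι → Matrix (Fin n) (Fin n) ℝ → Matrix (Fin n) (Fin n) ℝ)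
    (he : ∀ i, PolyMat (e i)) (hsk : ∀ i M, Mᵀ = -M → (e i M)ᵀ = -e i M)
    (M₀ : Matrix (Fin n) (Fin n) ℝ) (hM₀ : M₀ᵀ = -M₀)
    (hspan : ∀ X : Matrix (Fin n) (Fin n) ℝ, Xᵀ = -X →
      X ∈ Submodule.span ℝ (Set.range fun i => e i M₀)) :
    ∃ g ∈ polyFun n, g M₀ ≠ 0 ∧ ∀ M : Matrix (Fin n) (Fin n) ℝ, Mᵀ = -M → g M ≠ 0 →
      ∀ X : Matrix (Fin n) (Fin n) ℝ, Xᵀ = -X →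
        X ∈ Submodule.span ℝ (Set.range fun i => e i M) := by
  classical
  let pr : Matrix (Fin n) (Fin n) ℝ →ₗ[ℝ] skewSub n :=
    (skewLin n).codRestrict (skewSub n) (fun P => skewPart_transpose P)
  have hpr : ∀ X : Matrix (Fin n) (Fin n) ℝ, Xᵀ = -X → (pr X : Matrix (Fin n) (Fin n) ℝ) = X :=
    fun X hX => skewPart_of_skew hX
  let v : ι → skewSub n := fun i => pr (e i M₀)
  have hv : Submodule.span ℝ (Set.range v) = ⊤ := by
    rw [eq_top_iff]
    rintro ⟨X, hX⟩ -
    have h1 := Submodule.mem_map_of_mem (f := pr) (hspan X hX)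
    rw [Submodule.map_span, ← Set.range_comp] at h1
    have h2 : (⟨X, hX⟩ : skewSub n) = pr X := Subtype.ext (hpr X hX).symm
    rw [h2]
    exact h1
  obtain ⟨κ, a, ha, hκ, hli⟩ := exists_linearIndependent' ℝ v
  rw [hv] at hκ
  let b : Module.Basis κ ℝ (skewSub n) := Module.Basis.mk hli hκ.ge
  have : Fintype κ := FiniteDimensional.fintypeBasisIndex b
  refine ⟨fun M => b.det (fun k => pr (e (a k) M)), ?_, ?_, ?_⟩
  · have : (fun M => b.det (fun k => pr (e (a k) M)))
        = ∑ σ : Equiv.Perm κ, ((Equiv.Perm.sign σ : ℤ) : ℝ) •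
          ∏ k, (fun M => ((b.coord (σ k)).comp pr) (e (a k) M)) := by
      ext M
      rw [Module.Basis.det_apply, Matrix.det_apply']
      simp [Module.Basis.toMatrix_apply]
    rw [this]
    exact sum_mem fun σ _ => (polyFun n).smul_mem
      (prod_mem fun k _ => (he (a k)).linear _) _
  · have : (fun k => pr (e (a k) M₀)) = b := by
      ext1 k; simp [b, v]
    show b.det _ ≠ 0
    rw [this, b.det_self]; exact one_ne_zero
  · intro M hM hg X hX
    have h1 := ((Module.Basis.is_basis_iff_det b).2 (Ne.isUnit hg)).2
    have h2 : (⟨X, hX⟩ : skewSub n) ∈ Submodule.span ℝ (Set.range fun k => pr (e (a k) M)) := by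
      rw [h1]; trivial
    have h3 := Submodule.mem_map_of_mem (f := (skewSub n).subtype) h2
    rw [Submodule.map_span, ← Set.range_comp] at h3
    refine Submodule.span_mono ?_ h3
    rintro _ ⟨k, rfl⟩
    exact ⟨a k, (hpr _ (hsk _ M hM)).symm⟩

/-- Generators of `bigSpan`. -/
noncomputable def gens {n : ℕ} (A : Matrix (Fin n) (Fin n) ℝ) :
    ((ℝ × ℕ) ⊕ (soA A)) ⊕ (ℝ × ℕ) → Matrix (Fin n) (Fin n) ℝ → Matrix (Fin n) (Fin n) ℝ
  | .inl (.inl p), M => skewPart ((M + p.1 • A) ^ p.2)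
  | .inl (.inr X), _ => X.1
  | .inr p, M => M * skewPart ((M + p.1 • A) ^ p.2) - skewPart ((M + p.1 • A) ^ p.2) * M

lemma gens_span {n : ℕ} (A M : Matrix (Fin n) (Fin n) ℝ) :
    Submodule.span ℝ (Set.range fun i => gens A i M) = bigSpan A M := by
  rw [bigSpan, Submodule.map_span, ← Submodule.span_union, ← Submodule.span_union]
  congr 1
  ext X
  constructor
  · rintro ⟨(p | X) | p, rfl⟩
    · exact Or.inl (Or.inl ⟨p.1, p.2, rfl⟩)
    · exact Or.inl (Or.inr X.2)
    · exact Or.inr ⟨_, ⟨p.1, p.2, rfl⟩, rfl⟩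
  · rintro ((⟨x, j, rfl⟩ | h) | ⟨_, ⟨x, j, rfl⟩, rfl⟩)
    · exact ⟨.inl (.inl (x, j)), rfl⟩
    · exact ⟨.inl (.inr ⟨X, h⟩), rfl⟩
    · exact ⟨.inr (x, j), rfl⟩

lemma gens_poly {n : ℕ} (A : Matrix (Fin n) (Fin n) ℝ) (i) : PolyMat (gens A i) := by
  have h : ∀ p : ℝ × ℕ, PolyMat fun M => skewPart ((M + p.1 • A) ^ p.2) := fun p =>
    ((PolyMat.id'.add (PolyMat.const _)).pow _).skewPart
  rcases i with (p | X) | p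
  · exact h p
  · exact PolyMat.const _
  · exact (PolyMat.id'.mul (h p)).sub ((h p).mul PolyMat.id')

lemma gens_skew {n : ℕ} (A : Matrix (Fin n) (Fin n) ℝ) (i) (M : Matrix (Fin n) (Fin n) ℝ)
    (hM : Mᵀ = -M) : (gens A i M)ᵀ = -gens A i M := by
  rcases i with (p | X) | p
  · exact skewPart_transpose _
  · exact X.2.1
  · exact bracket_skew hM (skewPart_transpose _)

/-- Remark 1 of the paper: Let `A` be the block-scalar diagonal matrix
with pairwise distinct values `α p` on consecutive blocks of sizes `k 1, …, k r`, and
for `M ∈ so(n)` let `L_M` be the span of the gradients `π((M + λA)^j)` of the Manakov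
integrals. Then there is an open dense subset `U` of `so(n)` such that for every
`M ∈ U` the skew-orthogonal complement of `L_M` with respect to the Lie–Poisson
structure at `M` equals `L_M + so(n)_A`:
`{ξ ∈ so(n) : tr(M·[ξ, η]) = 0 ∀ η ∈ L_M} = L_M + so(n)_A`. -/
theorem manakov_skew_orthogonal_complement (n r : ℕ) (k : Fin r → ℕ)
    (hk : ∀ p, 0 < k p) (hsum : ∑ p, k p = n)
    (blk : Fin n → Fin r) (hmono : Monotone blk)
    (hcard : ∀ p, (Finset.univ.filter fun i => blk i = p).card = k p)
    (α : Fin r → ℝ) (hα : Function.Injective α)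
    (A : Matrix (Fin n) (Fin n) ℝ) (hA : A = Matrix.diagonal fun i => α (blk i))
    (L : Matrix (Fin n) (Fin n) ℝ → Submodule ℝ (Matrix (Fin n) (Fin n) ℝ))
    (hL : ∀ M, L M = Submodule.span ℝ (manakovGradients A M)) :
    ∃ U : Set {X : Matrix (Fin n) (Fin n) ℝ // Xᵀ = -X},
      IsOpen U ∧ Dense U ∧
      ∀ M ∈ U,
        {ξ : Matrix (Fin n) (Fin n) ℝ | ξᵀ = -ξ ∧
            ∀ η ∈ L M.1, ((M.1 : Matrix (Fin n) (Fin n) ℝ) * (ξ * η - η * ξ)).trace = 0}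
          = ↑(L M.1 ⊔ Submodule.span ℝ (soA A)) := by
  have hAt : Aᵀ = A := by rw [hA]; exact diagonal_transpose _
  obtain ⟨g, hg, hg0, hgs⟩ := generic_span (gens A) (gens_poly A) (gens_skew A) (triM n)
    (triM_transpose n) (fun X hX => by
      rw [gens_span, hA]; exact tri_bigSpan blk hmono α hα X hX)
  obtain ⟨ho, hd⟩ := polyFun_open_dense hg (triM n) (triM_transpose n) hg0
  refine ⟨_, ho, hd, fun M hM => ?_⟩
  have h := complement_of_bigSpan hAt M.2 (fun X hX => by
    rw [← gens_span]; exact hgs M.1 M.2 hM X hX)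
  rw [hL]
  ext X
  exact h X
end
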